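/- arXiv:0710.4375 — 2 statements merged into one kernel-verified Lean document; each statement's English description precedes it below -/
import Mathlib

section
/- Let Δ ⊂ ℝ^n (n ≥ 1) be the convex hull of a finite subset of ℤ^n with nonempty interior, φ_Δ(v) = log(Σ_{α ∈ Δ∩ℤ^n} e^{⟨α,v⟩}), χ : ℝ^n → ℝ smooth with compact support, φ = φ_Δ + χ, and φ_e the convex envelope of φ. With Λ_k and N_{k,p} as in the toric Bergman setup, let u_k(v) = k^{−1} log( Σ_{p ∈ Λ_k} e^{k⟨p,v⟩} / N_{k,p} ); each u_k is smooth and convex on ℝ^n. Then for every continuous compactly supported function f : ℝ^n → ℝ, ∫_{ℝ^n} f(v) det(D²u_k(v)) dv → ∫_{ℝ^n} f(v) MA[φ_e](v) dv as k → ∞. (This is the toric-model instance of the weak convergence of the Bergman volume forms (dd^c(k^{−1} log K_k))^n/n! to the equilibrium measure μ_φ.) -/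
open scoped RealInnerProductSpace
open MeasureTheory Filter

/-- The convex envelope of a function `φ : ℝⁿ → ℝ`: the pointwise supremum of all
convex minorants of `φ`. -/
noncomputable def convEnv {n : ℕ} (φ : EuclideanSpace ℝ (Fin n) → ℝ)
    (v : EuclideanSpace ℝ (Fin n)) : ℝ :=
  sSup {y : ℝ | ∃ g : EuclideanSpace ℝ (Fin n) → ℝ,
    ConvexOn ℝ Set.univ g ∧ (∀ w, g w ≤ φ w) ∧ y = g v}

/-- Abbreviation for Euclidean space. -/
abbrev EE (n : ℕ) := EuclideanSpace ℝ (Fin n)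

/-- `P` is a bounded field of subgradients of `g`, and second differences of `g` are bounded. -/
def Nice {n : ℕ} (g : EE n → ℝ) (P : EE n → EE n) (C R : ℝ) : Prop :=
  (∀ v w, g v + ⟪P v, w - v⟫ ≤ g w) ∧
  (∀ v h, g (v + h) + g (v - h) - 2 * g v ≤ C * ‖h‖ ^ 2) ∧ ∀ v, ‖P v‖ ≤ R

lemma Nice.upper {n : ℕ} {g : EE n → ℝ} {P : EE n → EE n} {C R : ℝ} (h : Nice g P C R)
    (v w : EE n) : g w ≤ g v + ⟪P v, w - v⟫ + C * ‖w - v‖ ^ 2 := by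
  have h1 := h.2.1 v (w - v)
  have h2 := h.1 v (v - (w - v))
  have e1 : v + (w - v) = w := by abel
  have e2 : v - (w - v) - v = -(w - v) := by abel
  rw [e1] at h1
  rw [e2, inner_neg_right] at h2
  linarith

lemma Nice.hasGradientAt {n : ℕ} {g : EE n → ℝ} {P : EE n → EE n} {C R : ℝ} (h : Nice g P C R)
    (v : EE n) : HasGradientAt g (P v) v := by
  rw [hasGradientAt_iff_hasFDerivAt, hasFDerivAt_iff_isLittleO]
  have : (fun w : EE n => g w - g v - (InnerProductSpace.toDual ℝ (EE n) (P v)) (w - v)) =O[nhds v]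
      fun w => ‖w - v‖ ^ 2 := by
    refine Asymptotics.IsBigO.of_bound C (Eventually.of_forall fun w => ?_)
    have h1 := h.1 v w
    have h2 := h.upper v w
    rw [InnerProductSpace.toDual_apply_apply, Real.norm_eq_abs, abs_of_nonneg (by linarith), norm_pow,
      norm_norm]
    linarith
  refine this.trans_isLittleO ?_
  have h3 : (fun w : EE n => ‖w - v‖ ^ 2) = (fun x : EE n => ‖x‖ ^ 2) ∘ fun w => w - v := rfl
  have h4 := (Asymptotics.isLittleO_norm_pow_id (E' := EE n) (n := 2) (by norm_num))
  have h5 : Tendsto (fun w : EE n => w - v) (nhds v) (nhds 0) := by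
    have : Tendsto (fun w : EE n => w - v) (nhds v) (nhds (v - v)) :=
      tendsto_id.sub tendsto_const_nhds
    simpa using this
  exact h4.comp_tendsto h5

lemma Nice.gradient_eq {n : ℕ} {g : EE n → ℝ} {P : EE n → EE n} {C R : ℝ} (h : Nice g P C R) :
    gradient g = P := by
  ext1 v
  exact (h.hasGradientAt v).gradient

/-- Uniqueness of subgradients. -/
lemma Nice.eq_of_sub {n : ℕ} {g : EE n → ℝ} {P : EE n → EE n} {C R : ℝ} (h : Nice g P C R)
    {v p : EE n} (hp : ∀ w, g v + ⟪p, w - v⟫ ≤ g w) : P v = p := by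
  by_contra hne
  have hq : 0 < ‖p - P v‖ := norm_pos_iff.2 (sub_ne_zero.2 (Ne.symm hne))
  set q := p - P v with hqd
  -- for every t > 0 : t |q|^2 <= C t^2 |q|^2
  have key : ∀ t : ℝ, 0 < t → 1 ≤ C * t := by
    intro t ht
    have h1 := hp (v + t • q)
    have h2 := h.upper v (v + t • q)
    rw [add_sub_cancel_left, inner_smul_right] at h1 h2
    have h3 : ⟪p, q⟫ = ⟪P v, q⟫ + ‖q‖ ^ 2 := by
      rw [← real_inner_self_eq_norm_sq, ← inner_add_left, hqd]; congr 1; abel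
    rw [norm_smul, Real.norm_eq_abs, abs_of_pos ht] at h2
    rw [h3] at h1
    have h4 : t * ‖q‖ ^ 2 * 1 ≤ t * ‖q‖ ^ 2 * (C * t) := by nlinarith
    exact le_of_mul_le_mul_left h4 (by positivity)
  have h1 := key 1 one_pos
  have hC : 0 < C := by linarith
  have h2 := key (1 / (2 * C)) (by positivity)
  have : C * (1 / (2 * C)) = 1 / 2 := by field_simp
  linarith

lemma Nice.lipschitz {n : ℕ} {g : EE n → ℝ} {P : EE n → EE n} {C R : ℝ} (h : Nice g P C R) :
    LipschitzWith (Real.toNNReal (4 * |C|)) P := by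
  refine LipschitzWith.of_dist_le_mul fun v w => ?_
  rw [Real.coe_toNNReal _ (by positivity), dist_eq_norm, dist_eq_norm]
  set q := P v - P w with hq
  rcases eq_or_ne q 0 with h0 | h0
  · rw [h0, norm_zero]; positivity
  have hqpos : 0 < ‖q‖ := norm_pos_iff.2 h0
  rcases eq_or_ne v w with hvw | hvw
  · exact absurd (by rw [hq, hvw, sub_self]) h0
  have hd : 0 < ‖v - w‖ := norm_pos_iff.2 (sub_ne_zero.2 hvw)
  set d := ‖v - w‖ with hdd
  set t := d / ‖q‖ with ht
  have htpos : 0 < t := by positivity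
  set z := v + t • q with hz
  have h1 := h.1 v z
  have h2 := h.upper w z
  have h3 := h.1 w v
  have e1 : z - v = t • q := by rw [hz]; abel
  have e2 : z - w = (v - w) + t • q := by rw [hz]; abel
  have e3 : ‖z - w‖ ≤ 2 * d := by
    rw [e2]
    refine (norm_add_le _ _).trans ?_
    rw [norm_smul, Real.norm_eq_abs, abs_of_pos htpos, ht, div_mul_cancel₀ _ hqpos.ne']
    linarith
  rw [e1, inner_smul_right] at h1
  have e4 : ⟪P w, z - w⟫ = ⟪P w, v - w⟫ + t * ⟪P w, q⟫ := by
    rw [e2, inner_add_right, inner_smul_right]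
  have e5 : ⟪P v, q⟫ = ⟪P w, q⟫ + ‖q‖ ^ 2 := by
    rw [← real_inner_self_eq_norm_sq, ← inner_add_left, hq]; congr 1; abel
  rw [e4] at h2
  rw [e5] at h1
  have h5 : t * ‖q‖ ^ 2 ≤ C * ‖z - w‖ ^ 2 := by nlinarith
  have h6 : C * ‖z - w‖ ^ 2 ≤ |C| * (2 * d) ^ 2 := by
    refine mul_le_mul (le_abs_self C) ?_ (by positivity) (abs_nonneg _)
    gcongr
  have h7 : t * ‖q‖ ^ 2 = ‖q‖ * d := by rw [ht]; field_simp
  have h8 : ‖q‖ * d ≤ (4 * |C| * d) * d := by nlinarith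
  exact le_of_mul_le_mul_right h8 hd

lemma Nice.lip_g {n : ℕ} {g : EE n → ℝ} {P : EE n → EE n} {C R : ℝ} (h : Nice g P C R)
    (v w : EE n) : g v - g w ≤ R * ‖v - w‖ := by
  have h1 := h.1 v w
  have h2 : ⟪P v, v - w⟫ ≤ R * ‖v - w‖ :=
    (real_inner_le_norm _ _).trans (by gcongr; exact h.2.2 v)
  have h3 : ⟪P v, w - v⟫ = - ⟪P v, v - w⟫ := by rw [← inner_neg_right]; congr 1; abel
  linarith

lemma Nice.continuous {n : ℕ} {g : EE n → ℝ} {P : EE n → EE n} {C R : ℝ} (h : Nice g P C R) :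
    Continuous g :=
  continuous_iff_continuousAt.2 fun v => (h.hasGradientAt v).hasFDerivAt.continuousAt

/-- Equality of subgradients propagates along segments. -/
lemma Nice.segment {n : ℕ} {g : EE n → ℝ} {P : EE n → EE n} {C R : ℝ} (h : Nice g P C R)
    {v w : EE n} (hvw : P v = P w) {t : ℝ} (ht0 : 0 ≤ t) (ht1 : t ≤ 1) :
    P (v + t • (w - v)) = P v := by
  apply h.eq_of_sub
  intro x
  set z := v + t • (w - v) with hz
  have h1 := h.1 z v
  have h2 := h.1 z w
  have h3 := h.1 v x
  have h4 := h.1 w v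
  have e1 : v - z = (-t) • (w - v) := by rw [hz, neg_smul]; abel
  have e2 : w - z = (1 - t) • (w - v) := by rw [hz, sub_smul, one_smul]; abel
  have e3 : x - z = (x - v) - t • (w - v) := by rw [hz]; abel
  have e4 : v - w = (-1 : ℝ) • (w - v) := by rw [neg_smul, one_smul]; abel
  rw [e1, inner_smul_right] at h1
  rw [e2, inner_smul_right] at h2
  rw [e4, inner_smul_right, ← hvw] at h4
  rw [e3, inner_sub_right, inner_smul_right]
  have h5 : g z ≤ (1 - t) * g v + t * g w := by
    nlinarith [mul_le_mul_of_nonneg_left h1 (sub_nonneg.2 ht1), mul_le_mul_of_nonneg_left h2 ht0]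
  nlinarith [mul_le_mul_of_nonneg_left h4 ht0]

/-- The good set: nondegenerate derivative. -/
def good {n : ℕ} (P : EE n → EE n) : Set (EE n) := {v | (fderiv ℝ P v).det ≠ 0}

lemma good_diff {n : ℕ} (hn : 1 ≤ n) {P : EE n → EE n} {v : EE n} (hv : v ∈ good P) :
    DifferentiableAt ℝ P v := by
  by_contra hd
  apply hv
  rw [fderiv_zero_of_not_differentiableAt hd]
  have : Module.finrank ℝ (EE n) ≠ 0 := by simp; omega
  rw [ContinuousLinearMap.det]
  simp only [ContinuousLinearMap.toLinearMap_zero]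
  rw [LinearMap.det_zero, zero_pow this]

lemma good_meas {n : ℕ} (P : EE n → EE n) : MeasurableSet (good P) := by
  have : Measurable fun v => (fderiv ℝ P v).det :=
    ContinuousLinearMap.continuous_det.measurable.comp (measurable_fderiv ℝ P)
  exact (this (measurableSet_singleton 0)).compl

lemma Nice.good_unique {n : ℕ} (hn : 1 ≤ n) {g : EE n → ℝ} {P : EE n → EE n} {C R : ℝ}
    (h : Nice g P C R) {v w : EE n} (hv : v ∈ good P) (hvw : P v = P w) : w = v := by
  by_contra hne
  have hne' : w - v ≠ 0 := sub_ne_zero.2 hne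
  have hd := (good_diff hn hv).hasFDerivAt
  have hline : HasDerivAt (fun t : ℝ => v + t • (w - v)) (w - v) 0 := by
    simpa using ((hasDerivAt_id (0 : ℝ)).smul_const (w - v)).const_add v
  have hcomp : HasDerivAt (fun t : ℝ => P (v + t • (w - v))) (fderiv ℝ P v (w - v)) 0 := by
    have hd' : HasFDerivAt P (fderiv ℝ P v) (v + (0 : ℝ) • (w - v)) := by simpa using hd
    exact hd'.comp_hasDerivAt (0 : ℝ) hline
  have h1 := hcomp.hasDerivWithinAt (s := Set.Icc 0 1)
  have h2 : HasDerivWithinAt (fun t : ℝ => P (v + t • (w - v))) 0 (Set.Icc 0 1) 0 := by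
    refine (hasDerivWithinAt_const (0 : ℝ) (Set.Icc (0:ℝ) 1) (P v)).congr ?_ (by simp)
    intro t ht
    exact h.segment hvw ht.1 ht.2
  have h3 := (uniqueDiffOn_Icc (zero_lt_one' ℝ) 0 (by simp)).eq_deriv _ h1 h2
  apply hv
  change LinearMap.det ((fderiv ℝ P v : EE n →L[ℝ] EE n) : EE n →ₗ[ℝ] EE n) = 0
  by_contra hdet
  have hinj : Function.Injective ((fderiv ℝ P v : EE n →L[ℝ] EE n) : EE n →ₗ[ℝ] EE n) := by
    rw [← LinearMap.ker_eq_bot]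
    by_contra hk
    exact hdet (LinearMap.det_eq_zero_iff_ker_ne_bot.2 hk)
  apply hne'
  apply hinj
  simpa using h3

/-- Accretive operators have nonnegative determinant. -/
lemma det_nonneg_of_inner {n : ℕ} (A : EE n →L[ℝ] EE n) (hA : ∀ h, 0 ≤ ⟪A h, h⟫) : 0 ≤ A.det := by
  let B : ℝ → (EE n →L[ℝ] EE n) := fun s => (1 - s) • ContinuousLinearMap.id ℝ (EE n) + s • A
  have hB : Continuous fun s => (B s).det :=
    ContinuousLinearMap.continuous_det.comp (by fun_prop)
  have hne : ∀ s ∈ Set.Ico (0 : ℝ) 1, (B s).det ≠ 0 := by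
    intro s hs hdet
    obtain ⟨x, hx, hx0⟩ := Submodule.exists_mem_ne_zero_of_ne_bot
      (LinearMap.det_eq_zero_iff_ker_ne_bot.1
        (show LinearMap.det ((B s : EE n →L[ℝ] EE n) : EE n →ₗ[ℝ] EE n) = 0 from hdet))
    have h1 : B s x = 0 := by simpa using hx
    have h2 : ⟪B s x, x⟫ = (1 - s) * ‖x‖ ^ 2 + s * ⟪A x, x⟫ := by
      simp [B, inner_add_left, inner_smul_left]
    rw [h1, inner_zero_left] at h2
    have h3 : 0 < (1 - s) * ‖x‖ ^ 2 := mul_pos (by linarith [hs.2]) (by positivity)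
    nlinarith [mul_nonneg hs.1 (hA x)]
  have h0 : (B 0).det = 1 := by
    simp [B, ContinuousLinearMap.det]
  have h1 : (B 1).det = A.det := by
    have : B 1 = A := by
      ext x : 1
      change (1 - 1 : ℝ) • x + (1 : ℝ) • A x = A x
      rw [sub_self, zero_smul, zero_add, one_smul]
    rw [this]
  rw [← h1]
  by_contra hlt
  push Not at hlt
  have himg := isPreconnected_Icc.intermediate_value (a := (1:ℝ)) (b := 0)
    (s := Set.Icc (0:ℝ) 1) (by simp) (by simp) (f := fun s => (B s).det) hB.continuousOn
  obtain ⟨s, hs, hs0⟩ := himg (show (0 : ℝ) ∈ _ from ⟨hlt.le, by rw [h0]; norm_num⟩)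
  rcases lt_or_eq_of_le hs.2 with h | h
  · exact hne s ⟨hs.1, h⟩ hs0
  · simp only [h] at hs0; linarith

lemma Nice.det_nonneg {n : ℕ} {g : EE n → ℝ} {P : EE n → EE n} {C R : ℝ}
    (h : Nice g P C R) (v : EE n) : 0 ≤ (fderiv ℝ P v).det := by
  apply det_nonneg_of_inner
  intro x
  by_cases hd : DifferentiableAt ℝ P v
  swap
  · rw [fderiv_zero_of_not_differentiableAt hd]; simp
  have hline : HasDerivAt (fun t : ℝ => v + t • x) x 0 := by
    simpa using ((hasDerivAt_id (0 : ℝ)).smul_const x).const_add v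
  have hcomp : HasDerivAt (fun t : ℝ => P (v + t • x)) (fderiv ℝ P v x) 0 := by
    have hd' : HasFDerivAt P (fderiv ℝ P v) (v + (0 : ℝ) • x) := by simpa using hd.hasFDerivAt
    exact hd'.comp_hasDerivAt (0 : ℝ) hline
  have h2 : HasDerivAt (fun t : ℝ => ⟪P (v + t • x), x⟫) ⟪fderiv ℝ P v x, x⟫ 0 := by
    simpa using hcomp.inner ℝ (hasDerivAt_const (0 : ℝ) x)
  have hmono : Monotone (fun t : ℝ => ⟪P (v + t • x), x⟫) := by
    intro s t hst
    rcases eq_or_lt_of_le hst with rfl | hst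
    · exact le_rfl
    have a1 := h.1 (v + s • x) (v + t • x)
    have a2 := h.1 (v + t • x) (v + s • x)
    have e1 : v + t • x - (v + s • x) = (t - s) • x := by rw [sub_smul]; abel
    have e2 : v + s • x - (v + t • x) = (-(t - s)) • x := by rw [neg_smul, sub_smul]; abel
    rw [e1, inner_smul_right] at a1
    rw [e2, inner_smul_right] at a2
    have : (t - s) * ⟪P (v + s • x), x⟫ ≤ (t - s) * ⟪P (v + t • x), x⟫ := by linarith
    exact le_of_mul_le_mul_left this (sub_pos.2 hst)
  rw [← h2.deriv]
  exact hmono.deriv_nonneg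

/-- Images of the bad set are null. -/
lemma Nice.bad_null {n : ℕ} {g : EE n → ℝ} {P : EE n → EE n} {C R : ℝ}
    (h : Nice g P C R) : volume (P '' (good P)ᶜ) = 0 := by
  have hsub : P '' (good P)ᶜ ⊆ P '' {v | ¬ DifferentiableAt ℝ P v} ∪
      P '' {v | DifferentiableAt ℝ P v ∧ (fderiv ℝ P v).det = 0} := by
    rw [← Set.image_union]
    apply Set.image_mono
    intro v hv
    by_cases hd : DifferentiableAt ℝ P v
    · right; exact ⟨hd, not_not.1 hv⟩
    · left; exact hd
  refine measure_mono_null hsub (measure_union_null ?_ ?_)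
  · have h0 : volume {v | ¬ DifferentiableAt ℝ P v} = 0 := h.lipschitz.ae_differentiableAt
    have hac : (volume : Measure (EE n)) ≪ Measure.hausdorffMeasure (Module.finrank ℝ (EE n)) :=
      Measure.absolutelyContinuous_isAddHaarMeasure _ _
    have hac' : Measure.hausdorffMeasure (Module.finrank ℝ (EE n)) ≪ (volume : Measure (EE n)) :=
      Measure.absolutelyContinuous_isAddHaarMeasure _ _
    apply hac
    have := h.lipschitz.hausdorffMeasure_image_le (d := (Module.finrank ℝ (EE n) : ℝ))
      (by positivity) {v | ¬ DifferentiableAt ℝ P v}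
    rw [hac' h0, mul_zero] at this
    exact le_antisymm this bot_le
  · exact addHaar_image_eq_zero_of_det_fderivWithin_eq_zero volume
      (f' := fderiv ℝ P)
      (fun v hv => hv.1.hasFDerivAt.hasFDerivWithinAt) (fun v hv => hv.2)

lemma Nice.injOn {n : ℕ} (hn : 1 ≤ n) {g : EE n → ℝ} {P : EE n → EE n} {C R : ℝ}
    (h : Nice g P C R) : Set.InjOn P (good P) := by
  intro v _ w hw hvw
  exact h.good_unique hn hw hvw.symm

lemma good_hasFDeriv {n : ℕ} (hn : 1 ≤ n) {P : EE n → EE n} (s : Set (EE n)) :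
    ∀ v ∈ good P, HasFDerivWithinAt P (fderiv ℝ P v) s v :=
  fun _ hv => (good_diff hn hv).hasFDerivAt.hasFDerivWithinAt

lemma Nice.meas_det {n : ℕ} (P : EE n → EE n) : Measurable fun v => (fderiv ℝ P v).det :=
  ContinuousLinearMap.continuous_det.measurable.comp (measurable_fderiv ℝ P)

lemma Nice.integrable_det {n : ℕ} (hn : 1 ≤ n) {g : EE n → ℝ} {P : EE n → EE n} {C R : ℝ}
    (h : Nice g P C R) : Integrable fun v => (fderiv ℝ P v).det := by
  refine ⟨(Nice.meas_det P).aestronglyMeasurable, ?_⟩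
  have h1 := lintegral_abs_det_fderiv_eq_addHaar_image volume (good_meas P)
    (good_hasFDeriv hn (good P)) (h.injOn hn)
  have h2 : volume (P '' good P) < ⊤ := by
    refine (measure_mono ?_).trans_lt (measure_closedBall_lt_top (x := (0 : EE n)) (r := R))
    rintro _ ⟨v, _, rfl⟩
    simpa using h.2.2 v
  rw [← h1] at h2
  rw [HasFiniteIntegral]
  refine lt_of_le_of_lt (le_of_eq ?_) h2
  rw [← lintegral_indicator (good_meas P)]
  congr 1
  ext v
  by_cases hv : v ∈ good P
  · rw [Set.indicator_of_mem hv, ← ofReal_norm_eq_enorm, Real.norm_eq_abs]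
  · rw [Set.indicator_of_notMem hv, not_not.1 hv]; simp

/-- The transported test function. -/
noncomputable def transp {n : ℕ} (f : EE n → ℝ) (P : EE n → EE n) : EE n → ℝ :=
  (P '' good P).indicator fun p => f (Function.invFunOn P (good P) p)

lemma transp_of_good {n : ℕ} (hn : 1 ≤ n) (f : EE n → ℝ) {g : EE n → ℝ} {P : EE n → EE n}
    {C R : ℝ} (h : Nice g P C R) {v : EE n} (hv : v ∈ good P) : transp f P (P v) = f v := by
  have hm : P v ∈ P '' good P := ⟨v, hv, rfl⟩
  rw [transp, Set.indicator_of_mem hm]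
  congr 1
  exact (h.injOn hn).leftInvOn_invFunOn hv

lemma transp_of_not {n : ℕ} (f : EE n → ℝ) {P : EE n → EE n}
    {p : EE n} (hp : p ∉ P '' good P) : transp f P p = 0 := by
  rw [transp, Set.indicator_of_notMem hp]

lemma Nice.image_meas {n : ℕ} (hn : 1 ≤ n) {g : EE n → ℝ} {P : EE n → EE n}
    {C R : ℝ} (h : Nice g P C R) : MeasurableSet (P '' good P) :=
  measurable_image_of_fderivWithin (good_meas P) (good_hasFDeriv hn _) (h.injOn hn)

lemma Nice.integral_transp {n : ℕ} (hn : 1 ≤ n) (f : EE n → ℝ) {g : EE n → ℝ} {P : EE n → EE n}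
    {C R : ℝ} (h : Nice g P C R) :
    ∫ v, f v * (fderiv ℝ P v).det = ∫ p, transp f P p := by
  rw [transp, integral_indicator (h.image_meas hn),
    integral_image_eq_integral_abs_det_fderiv_smul volume (good_meas P) (good_hasFDeriv hn _)
      (h.injOn hn), ← integral_indicator (good_meas P)]
  congr 1
  ext v
  by_cases hv : v ∈ good P
  · rw [Set.indicator_of_mem hv, (h.injOn hn).leftInvOn_invFunOn hv, abs_of_nonneg (h.det_nonneg v),
      smul_eq_mul, mul_comm]
  · rw [Set.indicator_of_notMem hv, not_not.1 hv, mul_zero]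

lemma Nice.transp_meas {n : ℕ} (hn : 1 ≤ n) {f : EE n → ℝ} (hf : Continuous f) {M : ℝ}
    (hM : ∀ v, ‖f v‖ ≤ M) {g : EE n → ℝ} {P : EE n → EE n}
    {C R : ℝ} (h : Nice g P C R) : AEStronglyMeasurable (transp f P) volume := by
  have hi : IntegrableOn (fun p => f (Function.invFunOn P (good P) p)) (P '' good P) := by
    rw [integrableOn_image_iff_integrableOn_abs_det_fderiv_smul volume (good_meas P)
      (good_hasFDeriv hn _) (h.injOn hn)]
    have h1 : Integrable fun v => f v * (fderiv ℝ P v).det :=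
      (h.integrable_det hn).bdd_mul hf.aestronglyMeasurable (Eventually.of_forall hM)
    refine h1.integrableOn.congr_fun ?_ (good_meas P)
    intro v hv
    simp only
    rw [(h.injOn hn).leftInvOn_invFunOn hv, abs_of_nonneg (h.det_nonneg v),
      smul_eq_mul, mul_comm]
  exact (hi.integrable_indicator (h.image_meas hn)).aestronglyMeasurable

/-- Pointwise convergence of equi-Lipschitz functions is uniform on compact sets. -/
lemma unif_of_equilip {n : ℕ} {ι : Type*} {l : Filter ι} {g : ι → EE n → ℝ} {g₀ : EE n → ℝ} {R : ℝ}
    (hl : ∀ᶠ i in l, ∀ v w, g i v - g i w ≤ R * ‖v - w‖) (hl₀ : ∀ v w, g₀ v - g₀ w ≤ R * ‖v - w‖)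
    (hR : 0 < R)
    (hlim : ∀ v, Tendsto (fun i => g i v) l (nhds (g₀ v))) {K : Set (EE n)} (hK : IsCompact K)
    {δ : ℝ} (hδ : 0 < δ) : ∀ᶠ i in l, ∀ v ∈ K, |g i v - g₀ v| < δ := by
  obtain ⟨t, htK, ht, hcov⟩ := hK.finite_cover_balls (e := δ / (4 * R)) (by positivity)
  have h1 : ∀ᶠ i in l, ∀ x ∈ t, |g i x - g₀ x| < δ / 2 := by
    rw [ht.eventually_all]
    intro x _
    have := (hlim x).eventually (Metric.ball_mem_nhds _ (half_pos hδ))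
    filter_upwards [this] with i hi
    rwa [Real.dist_eq] at hi
  filter_upwards [h1, hl] with i hi hli v hv
  obtain ⟨x, hx, hvx⟩ := Set.mem_iUnion₂.1 (hcov hv)
  rw [Metric.mem_ball, dist_eq_norm] at hvx
  have hb : R * ‖v - x‖ < δ / 4 := by
    rw [lt_div_iff₀ (by positivity)] at hvx
    linarith
  have hs : ‖x - v‖ = ‖v - x‖ := norm_sub_rev _ _
  have a1 := hli v x
  have a2 := hli x v
  have a3 := hl₀ v x
  have a4 := hl₀ x v
  rw [hs] at a2 a4
  have a5 := abs_lt.1 (hi x hx)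
  rw [abs_lt]
  constructor <;> linarith [a5.1, a5.2]

/-- Stability of gradient preimages. -/
lemma stability {n : ℕ} {ι : Type*} {l : Filter ι} {g : ι → EE n → ℝ} {P : ι → EE n → EE n}
    {C : ι → ℝ} {g₀ : EE n → ℝ} {P₀ : EE n → EE n} {C₀ R : ℝ} (hR : 0 < R)
    (hg : ∀ᶠ i in l, Nice (g i) (P i) (C i) R) (hg₀ : Nice g₀ P₀ C₀ R)
    (hlim : ∀ v, Tendsto (fun i => g i v) l (nhds (g₀ v)))
    {v p : EE n} (hv : P₀ v = p) (huniq : ∀ w, P₀ w = p → w = v) {ε : ℝ} (hε : 0 < ε) :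
    ∀ᶠ i in l, ∃ w ∈ Metric.ball v ε, P i w = p := by
  have hpos : ∀ w ≠ v, g₀ v + ⟪p, w - v⟫ < g₀ w := by
    intro w hw
    rcases lt_or_eq_of_le (hg₀.1 v w) with h | h
    · rwa [hv] at h
    · exfalso
      apply hw
      apply huniq
      apply hg₀.eq_of_sub
      intro x
      rw [← h, hv]
      have := hg₀.1 v x
      rw [hv] at this
      have e : x - v = (w - v) + (x - w) := by abel
      rw [e, inner_add_right] at this
      linarith
  -- positive gap on the sphere
  have hgap : ∃ δ > 0, ∀ w ∈ Metric.sphere v ε, g₀ v + ⟪p, w - v⟫ + δ ≤ g₀ w := by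
    rcases (Metric.sphere v ε).eq_empty_or_nonempty with he | hne
    · exact ⟨1, one_pos, fun w hw => by rw [he] at hw; exact hw.elim⟩
    · have hc : ContinuousOn (fun w => g₀ w - ⟪p, w - v⟫) (Metric.sphere v ε) := by
        have := hg₀.continuous
        fun_prop
      obtain ⟨w₀, hw₀, hmin⟩ := (isCompact_sphere v ε).exists_isMinOn hne hc
      refine ⟨g₀ w₀ - ⟪p, w₀ - v⟫ - g₀ v, ?_, ?_⟩
      · have := hpos w₀ (Metric.ne_of_mem_sphere hw₀ hε.ne')
        linarith
      · intro w hw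
        have := hmin hw
        simp only [Set.mem_setOf_eq] at this
        linarith
  obtain ⟨δ, hδ, hgap⟩ := hgap
  have hu := unif_of_equilip (hg.mono fun i hi => hi.lip_g) hg₀.lip_g hR hlim
    (isCompact_closedBall v ε) (δ := δ / 3) (by positivity)
  filter_upwards [hu, hg] with i hi hgi
  have hc : ContinuousOn (fun w => g i w - ⟪p, w - v⟫) (Metric.closedBall v ε) := by
    have := hgi.continuous
    fun_prop
  obtain ⟨w, hw, hmin⟩ := (isCompact_closedBall v ε).exists_isMinOn
    ⟨v, Metric.mem_closedBall_self hε.le⟩ hc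
  have hwb : w ∈ Metric.ball v ε := by
    rcases lt_or_eq_of_le (Metric.mem_closedBall.1 hw) with h | h
    · exact h
    · exfalso
      have h1 := hgap w h
      have h2 := hmin (Metric.mem_closedBall_self hε.le : v ∈ Metric.closedBall v ε)
      simp only [Set.mem_setOf_eq, sub_self, inner_zero_right, sub_zero] at h2
      have h3 := abs_lt.1 (hi w hw)
      have h4 := abs_lt.1 (hi v (Metric.mem_closedBall_self hε.le))
      linarith [h3.1, h4.2]
  refine ⟨w, hwb, ?_⟩
  have hloc : IsLocalMin (fun w => g i w - ⟪p, w - v⟫) w :=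
    hmin.isLocalMin (Metric.closedBall_mem_nhds_of_mem hwb)
  have hd : HasFDerivAt (fun w => g i w - ⟪p, w - v⟫)
      (InnerProductSpace.toDual ℝ (EE n) (P i w) - InnerProductSpace.toDual ℝ (EE n) p) w := by
    refine (hgi.hasGradientAt w).hasFDerivAt.sub ?_
    have := ((InnerProductSpace.toDual ℝ (EE n) p).hasFDerivAt (x := w - v)).comp w
      ((hasFDerivAt_id w).sub_const v)
    simpa [Function.comp_def] using this
  have h0 := hloc.hasFDerivAt_eq_zero hd
  rw [← map_sub] at h0
  have := (LinearIsometryEquiv.map_eq_zero_iff _).1 h0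
  exact sub_eq_zero.1 this

/-- The abstract weak convergence theorem. -/
lemma weak_conv {n : ℕ} (hn : 1 ≤ n) {g : ℕ → EE n → ℝ} {P : ℕ → EE n → EE n}
    {C : ℕ → ℝ} {g₀ : EE n → ℝ} {P₀ : EE n → EE n} {C₀ R : ℝ} (hR : 0 < R)
    (hg : ∀ᶠ k in atTop, Nice (g k) (P k) (C k) R) (hg₀ : Nice g₀ P₀ C₀ R)
    (hlim : ∀ v, Tendsto (fun k => g k v) atTop (nhds (g₀ v)))
    {f : EE n → ℝ} (hf : Continuous f) (hfc : HasCompactSupport f) :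
    Tendsto (fun k : ℕ => ∫ v, f v * (fderiv ℝ (P k) v).det) atTop
        (nhds (∫ v, f v * (fderiv ℝ P₀ v).det)) := by
  obtain ⟨M, hM⟩ := hf.bounded_above_of_compact_support hfc
  have hM0 : 0 ≤ M := (norm_nonneg _).trans (hM 0)
  rw [hg₀.integral_transp hn f]
  have heq : (fun k : ℕ => ∫ v, f v * (fderiv ℝ (P k) v).det) =ᶠ[atTop]
      fun k => ∫ p, transp f (P k) p := by
    filter_upwards [hg] with k hk
    exact hk.integral_transp hn f
  rw [tendsto_congr' heq]
  refine tendsto_integral_filter_of_dominated_convergence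
    ((Metric.closedBall (0 : EE n) R).indicator fun _ => M) ?_ ?_ ?_ ?_
  · filter_upwards [hg] with k hk
    exact hk.transp_meas hn hf hM
  · filter_upwards [hg] with k hk
    refine Eventually.of_forall fun p => ?_
    by_cases hp : p ∈ P k '' good (P k)
    · have hp' : p ∈ Metric.closedBall (0 : EE n) R := by
        obtain ⟨v, _, rfl⟩ := hp
        simpa using hk.2.2 v
      rw [Set.indicator_of_mem hp', transp, Set.indicator_of_mem hp]
      exact hM _
    · rw [transp_of_not f hp, norm_zero]
      exact Set.indicator_nonneg (fun _ _ => hM0) _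
  · rw [integrable_indicator_iff Metric.isClosed_closedBall.measurableSet]
    exact integrableOn_const (measure_closedBall_lt_top.ne)
  · have hbad : ∀ᵐ p : EE n, ∀ k, Nice (g k) (P k) (C k) R → p ∉ P k '' (good (P k))ᶜ := by
      rw [ae_all_iff]
      intro k
      by_cases hk : Nice (g k) (P k) (C k) R
      · have : ∀ᵐ p : EE n, p ∉ P k '' (good (P k))ᶜ := measure_eq_zero_iff_ae_notMem.1 hk.bad_null
        filter_upwards [this] with p hp _ using hp
      · exact Eventually.of_forall fun p h => absurd h hk
    have hbad₀ : ∀ᵐ p : EE n, p ∉ P₀ '' (good P₀)ᶜ := measure_eq_zero_iff_ae_notMem.1 hg₀.bad_null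
    filter_upwards [hbad, hbad₀] with p hp hp₀
    by_cases hpg : p ∈ P₀ '' good P₀
    · obtain ⟨v, hv, rfl⟩ := hpg
      rw [transp_of_good hn f hg₀ hv, Metric.tendsto_nhds]
      intro η hη
      obtain ⟨ε, hε, hfe⟩ := Metric.continuous_iff.1 hf v η hη
      have hst := stability hR hg hg₀ hlim (v := v) rfl
        (fun w hw => hg₀.good_unique hn hv hw.symm) hε
      filter_upwards [hst, hg] with k hk hgk
      obtain ⟨w, hw, hwp⟩ := hk
      have hwg : w ∈ good (P k) := by
        by_contra hc
        exact hp k hgk ⟨w, hc, hwp⟩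
      rw [← hwp, transp_of_good hn f hgk hwg]
      exact hfe w hw
    · rw [transp_of_not f hpg]
      have hno : ∀ v, P₀ v ≠ p := by
        intro v hv
        by_cases hvg : v ∈ good P₀
        · exact hpg ⟨v, hvg, hv⟩
        · exact hp₀ ⟨v, hvg, hv⟩
      have key : ∀ᶠ k in atTop, ∀ v ∈ tsupport f, P k v ≠ p := by
        have hloc : ∀ v ∈ tsupport f, ∃ t ∈ nhdsWithin v (tsupport f),
            ∀ᶠ k in atTop, ∀ w ∈ t, P k w ≠ p := by
          intro v _
          have : ∃ w, g₀ w < g₀ v + ⟪p, w - v⟫ := by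
            by_contra hc
            push Not at hc
            exact hno v (hg₀.eq_of_sub hc)
          obtain ⟨w, hw⟩ := this
          set δ := g₀ v + ⟪p, w - v⟫ - g₀ w with hδ
          have hδ0 : 0 < δ := by linarith
          have hp1 : 0 < R + ‖p‖ := by positivity
          refine ⟨Metric.ball v (δ / (2 * (R + ‖p‖))),
            mem_nhdsWithin_of_mem_nhds (Metric.ball_mem_nhds v (by positivity)), ?_⟩
          have c1 := (hlim v).eventually (Metric.ball_mem_nhds _ (show 0 < δ / 4 by positivity))
          have c2 := (hlim w).eventually (Metric.ball_mem_nhds _ (show 0 < δ / 4 by positivity))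
          filter_upwards [c1, c2, hg] with k h1 h2 hgk x hx hPx
          rw [Real.dist_eq] at h1 h2
          rw [Metric.mem_ball, dist_eq_norm, lt_div_iff₀ (by positivity)] at hx
          have b1 := hgk.1 x w
          rw [hPx] at b1
          have b2 := hgk.lip_g v x
          have e1 : w - x = (w - v) - (x - v) := by abel
          rw [e1, inner_sub_right] at b1
          have b3 : ⟪p, x - v⟫ ≤ ‖p‖ * ‖x - v‖ := real_inner_le_norm _ _
          rw [norm_sub_rev] at b2
          have a1 := abs_lt.1 h1
          have a2 := abs_lt.1 h2
          linarith [a1.1, a2.2]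
        refine IsCompact.induction_on (p := fun s => ∀ᶠ k in atTop, ∀ v ∈ s, P k v ≠ p)
          hfc.isCompact ?_ ?_ ?_ ?_
        · simp
        · intro s t hst ht
          filter_upwards [ht] with k hk v hv using hk v (hst hv)
        · intro s t hs ht
          filter_upwards [hs, ht] with k hk1 hk2 v hv
          exact hv.elim (hk1 v) (hk2 v)
        · exact hloc
      refine tendsto_const_nhds.congr' ?_
      filter_upwards [key, hg] with k hk hgk
      by_cases hpk : p ∈ P k '' good (P k)
      · obtain ⟨v, hv, rfl⟩ := hpk
        rw [transp_of_good hn f hgk hv]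
        symm
        by_contra hc
        exact hk v (subset_tsupport f hc) rfl
      · rw [transp_of_not f hpk]

/-- partition function -/
noncomputable def lseZ {n : ℕ} (F : Finset (EE n)) (c : EE n → ℝ) (κ : ℝ) (v : EE n) : ℝ :=
  ∑ p ∈ F, c p * Real.exp (κ * ⟪p, v⟫)

/-- barycenter -/
noncomputable def lseP {n : ℕ} (F : Finset (EE n)) (c : EE n → ℝ) (κ : ℝ) (v : EE n) : EE n :=
  (lseZ F c κ v)⁻¹ • ∑ p ∈ F, (c p * Real.exp (κ * ⟪p, v⟫)) • p

lemma lseZ_pos {n : ℕ} {F : Finset (EE n)} {c : EE n → ℝ} {κ : ℝ}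
    (hc : ∀ p ∈ F, 0 < c p) (hF : F.Nonempty) (v : EE n) : 0 < lseZ F c κ v :=
  Finset.sum_pos (fun p hp => mul_pos (hc p hp) (Real.exp_pos _)) hF

lemma lse_inner {n : ℕ} {F : Finset (EE n)} {c : EE n → ℝ} {κ : ℝ}
    (hc : ∀ p ∈ F, 0 < c p) (hF : F.Nonempty) (v h : EE n) :
    ∑ p ∈ F, c p * Real.exp (κ * ⟪p, v⟫) * (κ * ⟪p, h⟫ - κ * ⟪lseP F c κ v, h⟫) = 0 := by
  have hZ := lseZ_pos (κ := κ) hc hF v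
  have h1 : ⟪lseP F c κ v, h⟫ = (lseZ F c κ v)⁻¹ *
      ∑ p ∈ F, c p * Real.exp (κ * ⟪p, v⟫) * ⟪p, h⟫ := by
    rw [lseP, real_inner_smul_left, sum_inner]
    simp only [real_inner_smul_left]
  have h2 : lseZ F c κ v * ⟪lseP F c κ v, h⟫ =
      ∑ p ∈ F, c p * Real.exp (κ * ⟪p, v⟫) * ⟪p, h⟫ := by
    rw [h1, mul_inv_cancel_left₀ hZ.ne']
  calc _ = κ * (∑ p ∈ F, c p * Real.exp (κ * ⟪p, v⟫) * ⟪p, h⟫)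
        - κ * ((∑ p ∈ F, c p * Real.exp (κ * ⟪p, v⟫)) * ⟪lseP F c κ v, h⟫) := by
        rw [Finset.sum_mul, Finset.mul_sum, Finset.mul_sum, ← Finset.sum_sub_distrib]
        refine Finset.sum_congr rfl fun p _ => ?_
        ring
    _ = 0 := by rw [← h2, lseZ]; ring

lemma lse_expand {n : ℕ} {F : Finset (EE n)} {c : EE n → ℝ} {κ : ℝ}
    (hc : ∀ p ∈ F, 0 < c p) (hF : F.Nonempty) (v h : EE n) :
    ∑ p ∈ F, c p * Real.exp (κ * ⟪p, v⟫) * (Real.exp (κ * ⟪lseP F c κ v, h⟫) *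
      (κ * ⟪p, h⟫ - κ * ⟪lseP F c κ v, h⟫ + 1)) =
      Real.exp (κ * ⟪lseP F c κ v, h⟫) * lseZ F c κ v := by
  have h1 := lse_inner (κ := κ) hc hF v h
  calc _ = Real.exp (κ * ⟪lseP F c κ v, h⟫) *
      (∑ p ∈ F, c p * Real.exp (κ * ⟪p, v⟫) * (κ * ⟪p, h⟫ - κ * ⟪lseP F c κ v, h⟫)
        + ∑ p ∈ F, c p * Real.exp (κ * ⟪p, v⟫)) := by
        rw [← Finset.sum_add_distrib, Finset.mul_sum]
        refine Finset.sum_congr rfl fun p _ => ?_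
        ring
    _ = _ := by rw [h1, zero_add, lseZ]

lemma lse_term {n : ℕ} {c : EE n → ℝ} {κ : ℝ} (p v h : EE n) :
    c p * Real.exp (κ * ⟪p, v + h⟫) = c p * Real.exp (κ * ⟪p, v⟫) * Real.exp (κ * ⟪p, h⟫) := by
  rw [inner_add_right, mul_add, Real.exp_add]; ring

lemma exp_tangent (m x : ℝ) : Real.exp m * (x - m + 1) ≤ Real.exp x := by
  have h1 := Real.add_one_le_exp (x - m)
  have h2 : Real.exp x = Real.exp m * Real.exp (x - m) := by rw [← Real.exp_add]; congr 1; ring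
  rw [h2]
  exact mul_le_mul_of_nonneg_left h1 (Real.exp_pos m).le

lemma exp_tangent_lt {m x : ℝ} (h : x ≠ m) : Real.exp m * (x - m + 1) < Real.exp x := by
  have h1 := Real.add_one_lt_exp (sub_ne_zero.2 h)
  have h2 : Real.exp x = Real.exp m * Real.exp (x - m) := by rw [← Real.exp_add]; congr 1; ring
  rw [h2]
  exact mul_lt_mul_of_pos_left h1 (Real.exp_pos m)

lemma lse_sub {n : ℕ} {F : Finset (EE n)} {c : EE n → ℝ} {κ : ℝ}
    (hc : ∀ p ∈ F, 0 < c p) (hF : F.Nonempty) (v h : EE n) :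
    Real.exp (κ * ⟪lseP F c κ v, h⟫) * lseZ F c κ v ≤ lseZ F c κ (v + h) := by
  rw [← lse_expand hc hF, lseZ]
  refine Finset.sum_le_sum fun p hp => ?_
  rw [lse_term]
  exact mul_le_mul_of_nonneg_left (exp_tangent _ _) (mul_pos (hc p hp) (Real.exp_pos _)).le

lemma lse_sub_lt {n : ℕ} {F : Finset (EE n)} {c : EE n → ℝ} {κ : ℝ}
    (hc : ∀ p ∈ F, 0 < c p) (hF : F.Nonempty) (v h : EE n)
    (hne : ∃ p ∈ F, κ * ⟪p, h⟫ ≠ κ * ⟪lseP F c κ v, h⟫) :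
    Real.exp (κ * ⟪lseP F c κ v, h⟫) * lseZ F c κ v < lseZ F c κ (v + h) := by
  rw [← lse_expand hc hF, lseZ]
  obtain ⟨p, hp, hne⟩ := hne
  refine Finset.sum_lt_sum (fun p hp => ?_) ⟨p, hp, ?_⟩
  · rw [lse_term]
    exact mul_le_mul_of_nonneg_left (exp_tangent _ _) (mul_pos (hc p hp) (Real.exp_pos _)).le
  · rw [lse_term]
    exact mul_lt_mul_of_pos_left (exp_tangent_lt hne) (mul_pos (hc p hp) (Real.exp_pos _))

lemma lse_sd {n : ℕ} {F : Finset (EE n)} {c : EE n → ℝ} {κ R : ℝ}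
    (hc : ∀ p ∈ F, 0 < c p) (hR : ∀ p ∈ F, ‖p‖ ≤ R) (hκ : 0 < κ) (v h : EE n) :
    lseZ F c κ (v + h) * lseZ F c κ (v - h) ≤
      lseZ F c κ v ^ 2 * Real.exp (2 * κ ^ 2 * R ^ 2 * ‖h‖ ^ 2) := by
  set a : EE n → ℝ := fun p => c p * Real.exp (κ * ⟪p, v⟫) with ha
  have hap : ∀ p ∈ F, 0 < a p := fun p hp => mul_pos (hc p hp) (Real.exp_pos _)
  have e1 : lseZ F c κ (v + h) = ∑ p ∈ F, a p * Real.exp (κ * ⟪p, h⟫) :=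
    Finset.sum_congr rfl fun p _ => lse_term p v h
  have e2 : lseZ F c κ (v - h) = ∑ p ∈ F, a p * Real.exp (-(κ * ⟪p, h⟫)) := by
    refine Finset.sum_congr rfl fun p _ => ?_
    rw [sub_eq_add_neg, lse_term, inner_neg_right, mul_neg]
  have e3 : lseZ F c κ v = ∑ p ∈ F, a p := rfl
  set X := ∑ p ∈ F, ∑ q ∈ F, a p * a q * Real.exp (κ * ⟪p, h⟫ - κ * ⟪q, h⟫) with hX
  have e4 : lseZ F c κ (v + h) * lseZ F c κ (v - h) = X := by
    rw [e1, e2, Finset.sum_mul_sum]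
    refine Finset.sum_congr rfl fun p _ => Finset.sum_congr rfl fun q _ => ?_
    rw [sub_eq_add_neg, Real.exp_add]; ring
  have e5 : X = ∑ p ∈ F, ∑ q ∈ F, a p * a q * Real.exp (κ * ⟪q, h⟫ - κ * ⟪p, h⟫) := by
    rw [hX, Finset.sum_comm]
    refine Finset.sum_congr rfl fun p _ => Finset.sum_congr rfl fun q _ => ?_
    ring
  have e6 : 2 * X = ∑ p ∈ F, ∑ q ∈ F, 2 * (a p * a q * Real.cosh (κ * ⟪p, h⟫ - κ * ⟪q, h⟫)) := by
    rw [two_mul]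
    nth_rewrite 2 [e5]
    rw [hX, ← Finset.sum_add_distrib]
    refine Finset.sum_congr rfl fun p _ => ?_
    rw [← Finset.sum_add_distrib]
    refine Finset.sum_congr rfl fun q _ => ?_
    rw [Real.cosh_eq, neg_sub]; ring
  have e7 : ∑ p ∈ F, ∑ q ∈ F, 2 * (a p * a q * Real.cosh (κ * ⟪p, h⟫ - κ * ⟪q, h⟫)) ≤
      ∑ p ∈ F, ∑ q ∈ F, 2 * (a p * a q * Real.exp (2 * κ ^ 2 * R ^ 2 * ‖h‖ ^ 2)) := by
    refine Finset.sum_le_sum fun p hp => Finset.sum_le_sum fun q hq => ?_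
    have hpq : 0 < a p * a q := mul_pos (hap p hp) (hap q hq)
    have : Real.cosh (κ * ⟪p, h⟫ - κ * ⟪q, h⟫) ≤ Real.exp (2 * κ ^ 2 * R ^ 2 * ‖h‖ ^ 2) := by
      refine (Real.cosh_le_exp_half_sq _).trans (Real.exp_le_exp.2 ?_)
      have b1 : κ * ⟪p, h⟫ - κ * ⟪q, h⟫ = κ * ⟪p - q, h⟫ := by rw [inner_sub_left]; ring
      have b2 : |⟪p - q, h⟫| ≤ 2 * R * ‖h‖ := by
        refine (abs_real_inner_le_norm _ _).trans ?_
        gcongr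
        refine (norm_sub_le _ _).trans ?_
        linarith [hR p hp, hR q hq]
      have b3 : ⟪p - q, h⟫ ^ 2 ≤ (2 * R * ‖h‖) ^ 2 := by
        rw [← sq_abs]
        gcongr
      rw [b1, mul_pow]
      nlinarith [mul_le_mul_of_nonneg_left b3 (sq_nonneg κ)]
    gcongr
  have e8 : ∑ p ∈ F, ∑ q ∈ F, 2 * (a p * a q * Real.exp (2 * κ ^ 2 * R ^ 2 * ‖h‖ ^ 2)) =
      2 * (lseZ F c κ v ^ 2 * Real.exp (2 * κ ^ 2 * R ^ 2 * ‖h‖ ^ 2)) := by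
    rw [e3, sq (∑ p ∈ F, a p), Finset.sum_mul_sum]
    simp only [← Finset.mul_sum, ← Finset.sum_mul]
  rw [e4]
  linarith

lemma lse_nice {n : ℕ} {F : Finset (EE n)} {c : EE n → ℝ} {κ R : ℝ}
    (hc : ∀ p ∈ F, 0 < c p) (hF : F.Nonempty) (hR : ∀ p ∈ F, ‖p‖ ≤ R) (hκ : 0 < κ) :
    Nice (fun v => κ⁻¹ * Real.log (lseZ F c κ v)) (lseP F c κ) (2 * κ * R ^ 2) R := by
  have hZ : ∀ v, 0 < lseZ F c κ v := lseZ_pos hc hF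
  refine ⟨fun v w => ?_, fun v h => ?_, fun v => ?_⟩
  · have h1 := lse_sub (κ := κ) hc hF v (w - v)
    rw [add_sub_cancel] at h1
    have h2 := Real.log_le_log (mul_pos (Real.exp_pos _) (hZ v)) h1
    rw [Real.log_mul (Real.exp_pos _).ne' (hZ v).ne', Real.log_exp] at h2
    have h3 : κ⁻¹ * (κ * ⟪lseP F c κ v, w - v⟫ + Real.log (lseZ F c κ v)) ≤
      κ⁻¹ * Real.log (lseZ F c κ w) := mul_le_mul_of_nonneg_left h2 (by positivity)
    rw [mul_add, inv_mul_cancel_left₀ hκ.ne'] at h3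
    linarith
  · have h1 := lse_sd hc hR hκ v h
    have h2 := Real.log_le_log (mul_pos (hZ _) (hZ _)) h1
    rw [Real.log_mul (hZ _).ne' (hZ _).ne', Real.log_mul (pow_pos (hZ v) 2).ne'
      (Real.exp_pos _).ne', Real.log_exp, Real.log_pow] at h2
    have h3 := mul_le_mul_of_nonneg_left h2 (show 0 ≤ κ⁻¹ by positivity)
    have h4 : κ⁻¹ * (2 * κ ^ 2 * R ^ 2 * ‖h‖ ^ 2) = 2 * κ * R ^ 2 * ‖h‖ ^ 2 := by
      field_simp
    push_cast at h3
    simp only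
    nlinarith
  · rw [lseP, norm_smul, norm_inv, Real.norm_eq_abs, abs_of_pos (hZ v), inv_mul_le_iff₀ (hZ v)]
    refine (norm_sum_le _ _).trans ?_
    rw [lseZ, Finset.sum_mul]
    refine Finset.sum_le_sum fun p hp => ?_
    have : 0 < c p * Real.exp (κ * ⟪p, v⟫) := mul_pos (hc p hp) (Real.exp_pos _)
    rw [norm_smul, Real.norm_eq_abs, abs_of_pos this]
    exact mul_le_mul_of_nonneg_left (hR p hp) this.le

/-- Strict convexity when the points of `F` are not contained in a hyperplane. -/
lemma lse_inj {n : ℕ} {F : Finset (EE n)} {c : EE n → ℝ}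
    (hc : ∀ p ∈ F, 0 < c p) (hF : F.Nonempty)
    (hspan : ∀ (h : EE n) (m : ℝ), (∀ p ∈ F, ⟪p, h⟫ = m) → h = 0) :
    Function.Injective (lseP F c 1) := by
  intro v w hvw
  by_contra hne
  have hZ : ∀ v, 0 < lseZ F c 1 v := lseZ_pos hc hF
  have hlt : ∀ v h : EE n, h ≠ 0 →
      ⟪lseP F c 1 v, h⟫ + Real.log (lseZ F c 1 v) < Real.log (lseZ F c 1 (v + h)) := by
    intro v h hh
    have h1 := lse_sub_lt (κ := 1) hc hF v h (by
      by_contra hcon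
      push Not at hcon
      exact hh (hspan h _ fun p hp => by simpa using hcon p hp))
    have h2 := Real.log_lt_log (mul_pos (Real.exp_pos _) (hZ v)) h1
    rwa [Real.log_mul (Real.exp_pos _).ne' (hZ v).ne', Real.log_exp, one_mul] at h2
  have h1 := hlt v (w - v) (sub_ne_zero.2 (Ne.symm hne))
  have h2 := hlt w (v - w) (sub_ne_zero.2 hne)
  rw [add_sub_cancel] at h1 h2
  rw [← hvw, ← neg_sub, inner_neg_right] at h2
  linarith

lemma Nice.ball_pos {n : ℕ} (hn : 1 ≤ n) {g : EE n → ℝ} {P : EE n → EE n} {C R : ℝ} (hR : 0 < R)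
    (h : Nice g P C R) (hinj : Function.Injective P) (v : EE n) {ε : ℝ} (hε : 0 < ε) :
    0 < ∫ w in Metric.ball v ε, (fderiv ℝ P w).det := by
  set p := P v with hp
  have hg : ∀ᶠ q in nhds p, Nice (fun w => g w - ⟪q - p, w⟫) (fun w => P w - (q - p)) C (R + 1) := by
    filter_upwards [Metric.ball_mem_nhds p one_pos] with q hq
    refine ⟨fun a b => ?_, fun a b => ?_, fun a => ?_⟩
    · have := h.1 a b
      rw [inner_sub_left (P a)]
      simp only [inner_sub_right (q - p)]
      linarith
    · have := h.2.1 a b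
      simp only [inner_sub_right (q - p), inner_add_right]
      linarith
    · rw [Metric.mem_ball, dist_eq_norm] at hq
      exact (norm_sub_le _ _).trans (add_le_add (h.2.2 a) hq.le)
  have h' : Nice g P C (R + 1) := ⟨h.1, h.2.1, fun a => (h.2.2 a).trans (by linarith)⟩
  have hlim : ∀ w, Tendsto (fun q => g w - ⟪q - p, w⟫) (nhds p) (nhds (g w)) := by
    intro w
    have : Continuous fun q : EE n => g w - ⟪q - p, w⟫ := by fun_prop
    simpa using this.tendsto p
  have hst := stability (by linarith) hg h' hlim (v := v) rfl (fun w hw => hinj hw) hε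
  obtain ⟨r, hr, hball⟩ := Metric.eventually_nhds_iff_ball.1 hst
  have hsub : Metric.ball p r ⊆ P '' (Metric.ball v ε ∩ good P) ∪ P '' (good P)ᶜ := by
    intro q hq
    obtain ⟨w, hw, hwq⟩ := hball q hq
    have hPw : P w = q := by
      have : P w = (P w - (q - p)) + (q - p) := by abel
      rw [this, hwq, ← hp]; abel
    by_cases hwg : w ∈ good P
    · exact Or.inl ⟨w, ⟨hw, hwg⟩, hPw⟩
    · exact Or.inr ⟨w, hwg, hPw⟩
  have hvol : 0 < volume (P '' (Metric.ball v ε ∩ good P)) := by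
    have h1 : 0 < volume (Metric.ball p r) := Metric.measure_ball_pos _ _ hr
    have h2 := (measure_mono hsub).trans (measure_union_le (μ := volume) _ _)
    rw [h.bad_null, add_zero] at h2
    exact h1.trans_le h2
  have hms : MeasurableSet (Metric.ball v ε ∩ good P) :=
    measurableSet_ball.inter (good_meas P)
  rw [← lintegral_abs_det_fderiv_eq_addHaar_image volume hms
    (fun w hw => good_hasFDeriv hn _ w hw.2) ((h.injOn hn).mono Set.inter_subset_right)] at hvol
  refine lt_of_le_of_ne (integral_nonneg fun w => h.det_nonneg w) fun h0 => ?_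
  have h3 := (setIntegral_eq_zero_iff_of_nonneg_ae
    (Eventually.of_forall fun w => h.det_nonneg w) (h.integrable_det hn).integrableOn).1 h0.symm
  have h4 : ∀ᵐ w ∂(volume.restrict (Metric.ball v ε ∩ good P)), (fderiv ℝ P w).det = 0 :=
    ae_mono (Measure.restrict_mono Set.inter_subset_left le_rfl) h3
  have h5 : ∫⁻ w in Metric.ball v ε ∩ good P, ENNReal.ofReal |(fderiv ℝ P w).det| = 0 := by
    rw [lintegral_congr_ae (g := fun _ => 0)]
    · simp
    · filter_upwards [h4] with w hw
      rw [hw]; simp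
  exact hvol.ne' h5

/-- Existence of subgradients. -/
lemma exists_subgrad {n : ℕ} {g : EE n → ℝ} (hg : ConvexOn ℝ Set.univ g) (v : EE n) :
    ∃ p : EE n, ∀ w, g v + ⟪p, w - v⟫ ≤ g w := by
  have hcont : Continuous g := hg.locallyLipschitz.continuous
  set T : Set (EE n × ℝ) := {x | x.1 ∈ Set.univ ∧ g x.1 < x.2} with hT
  have hTc : Convex ℝ T := hg.convex_strict_epigraph
  have hTo : IsOpen T := by
    have : T = {x | g x.1 < x.2} := by ext; simp [hT]
    rw [this]
    exact isOpen_lt (hcont.comp continuous_fst) continuous_snd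
  have hx : ((v, g v) : EE n × ℝ) ∉ T := by simp [hT]
  obtain ⟨L, hL⟩ := geometric_hahn_banach_point_open hTc hTo hx
  have hdec : ∀ x t, L (x, t) = L (x, 0) + t * L (0, 1) := by
    intro x t
    have : ((x, t) : EE n × ℝ) = (x, 0) + t • (0, 1) := by simp
    rw [this, map_add, map_smul, smul_eq_mul]
  have hc : 0 < L (0, 1) := by
    have := hL (v, g v + 1) (by simp [hT])
    rw [hdec, hdec v (g v + 1)] at this
    linarith
  set c := L (0, 1) with hcd
  have hle : ∀ w, L (v, 0) + g v * c ≤ L (w, 0) + g w * c := by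
    intro w
    refine le_of_forall_pos_lt_add fun ε hε => ?_
    have := hL (w, g w + ε / c) (by simp [hT]; positivity)
    rw [hdec, hdec w] at this
    rw [add_mul, div_mul_cancel₀ _ hc.ne'] at this
    linarith
  let l : EE n →L[ℝ] ℝ := L.comp (ContinuousLinearMap.inl ℝ (EE n) ℝ)
  have hl : ∀ x, l x = L (x, 0) := fun x => rfl
  refine ⟨(-c⁻¹) • (InnerProductSpace.toDual ℝ (EE n)).symm l, fun w => ?_⟩
  rw [real_inner_smul_left, InnerProductSpace.toDual_symm_apply, map_sub, hl, hl]
  have h1 := hle w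
  have h2 := mul_le_mul_of_nonneg_left h1 (inv_pos.2 hc).le
  have e1 : c⁻¹ * (g v * c) = g v := by field_simp
  have e2 : c⁻¹ * (g w * c) = g w := by field_simp
  rw [mul_add, mul_add, e1, e2] at h2
  linarith

lemma le_convEnv {n : ℕ} {φ g : EE n → ℝ} (hg : ConvexOn ℝ Set.univ g) (hle : ∀ w, g w ≤ φ w)
    (v : EE n) : g v ≤ convEnv φ v := by
  refine le_csSup ⟨φ v, ?_⟩ ⟨g, hg, hle, rfl⟩
  rintro y ⟨g', _, h, rfl⟩
  exact h v

lemma convEnv_le {n : ℕ} {φ g : EE n → ℝ} (hg : ConvexOn ℝ Set.univ g) (hle : ∀ w, g w ≤ φ w)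
    (v : EE n) : convEnv φ v ≤ φ v := by
  refine csSup_le ⟨_, g, hg, hle, rfl⟩ ?_
  rintro y ⟨g', _, h, rfl⟩
  exact h v

lemma convEnv_convex {n : ℕ} {φ g : EE n → ℝ} (hg : ConvexOn ℝ Set.univ g) (hle : ∀ w, g w ≤ φ w) :
    ConvexOn ℝ Set.univ (convEnv φ) := by
  refine ⟨convex_univ, fun x _ y _ a b ha hb hab => ?_⟩
  refine csSup_le ⟨_, g, hg, hle, rfl⟩ ?_
  rintro z ⟨g', hg', h, rfl⟩
  refine (hg'.2 (Set.mem_univ x) (Set.mem_univ y) ha hb hab).trans ?_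
  simp only [smul_eq_mul]
  have h1 := le_convEnv hg' h x
  have h2 := le_convEnv hg' h y
  gcongr

lemma affine_convex {n : ℕ} (p : EE n) (v : EE n) (b : ℝ) :
    ConvexOn ℝ Set.univ fun w : EE n => b + ⟪p, w - v⟫ := by
  refine ⟨convex_univ, fun x _ y _ s t _ _ hst => le_of_eq ?_⟩
  simp only [smul_eq_mul, inner_sub_right, inner_add_right, inner_smul_right]
  have : s = 1 - t := by linarith
  subst this
  ring

lemma convEnv_sd {n : ℕ} {φ g : EE n → ℝ} (hg : ConvexOn ℝ Set.univ g) (hle : ∀ w, g w ≤ φ w)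
    {C : ℝ} (hC : ∀ v h, φ (v + h) + φ (v - h) - 2 * φ v ≤ C * ‖h‖ ^ 2) (v h : EE n) :
    convEnv φ (v + h) + convEnv φ (v - h) - 2 * convEnv φ v ≤ C * ‖h‖ ^ 2 := by
  have hE := convEnv_convex hg hle
  have key : (fun w => (1 / 2 : ℝ) * convEnv φ (w + h) + (1 / 2) * convEnv φ (w - h) - C * ‖h‖ ^ 2 / 2)
      v ≤ convEnv φ v := by
    refine le_convEnv (φ := φ) (g := fun w => (1 / 2 : ℝ) * convEnv φ (w + h) +
      (1 / 2) * convEnv φ (w - h) - C * ‖h‖ ^ 2 / 2) ?_ ?_ v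
    · refine ⟨convex_univ, fun x _ y _ s t hs ht hst => ?_⟩
      have h1 := hE.2 (Set.mem_univ (x + h)) (Set.mem_univ (y + h)) hs ht hst
      have h2 := hE.2 (Set.mem_univ (x - h)) (Set.mem_univ (y - h)) hs ht hst
      have e1 : s • (x + h) + t • (y + h) = s • x + t • y + h := by
        have : h = (s + t) • h := by rw [hst, one_smul]
        nth_rewrite 3 [this]
        rw [smul_add, smul_add, add_smul]; abel
      have e2 : s • (x - h) + t • (y - h) = s • x + t • y - h := by
        have : h = (s + t) • h := by rw [hst, one_smul]
        nth_rewrite 3 [this]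
        rw [smul_sub, smul_sub, add_smul]; abel
      rw [e1] at h1
      rw [e2] at h2
      simp only [smul_eq_mul] at h1 h2 ⊢
      have : s = 1 - t := by linarith
      subst this
      linarith
    · intro w
      have h1 := hC w h
      have h2 := convEnv_le hg hle (w + h)
      have h3 := convEnv_le hg hle (w - h)
      linarith
  simp only at key
  linarith

lemma chi_sd {n : ℕ} {χ : EE n → ℝ} (hχ : ContDiff ℝ (⊤ : ℕ∞) χ) (hχc : HasCompactSupport χ) :
    ∃ C, ∀ v h, χ (v + h) + χ (v - h) - 2 * χ v ≤ C * ‖h‖ ^ 2 := by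
  have h1 : ContDiff ℝ 1 (fderiv ℝ χ) := hχ.fderiv_right (by norm_cast)
  obtain ⟨K, hK⟩ := ContDiff.lipschitzWith_of_hasCompactSupport (hχc.fderiv ℝ) h1 (by norm_num)
  refine ⟨2 * K, fun v h => ?_⟩
  have hd : ∀ x, HasFDerivAt χ (fderiv ℝ χ x) x := fun x =>
    (hχ.differentiable (by simp) x).hasFDerivAt
  have hder : ∀ t : ℝ, HasDerivAt (fun t : ℝ => χ (v + t • h) + χ (v - t • h))
      (fderiv ℝ χ (v + t • h) h - fderiv ℝ χ (v - t • h) h) t := by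
    intro t
    have l1 : HasDerivAt (fun t : ℝ => v + t • h) h t := by
      simpa using ((hasDerivAt_id t).smul_const h).const_add v
    have l2 : HasDerivAt (fun t : ℝ => v - t • h) (-h) t := by
      simpa using ((hasDerivAt_id t).smul_const h).const_sub v
    have := ((hd _).comp_hasDerivAt t l1).add ((hd _).comp_hasDerivAt t l2)
    rw [map_neg, ← sub_eq_add_neg] at this
    exact this
  obtain ⟨t, ht, hmv⟩ := exists_hasDerivAt_eq_slope _ _ (zero_lt_one' ℝ)
    (fun t _ => (hder t).continuousAt.continuousWithinAt) (fun t _ => hder t)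
  simp only [one_smul, zero_smul, add_zero, sub_zero, div_one] at hmv
  have hb : fderiv ℝ χ (v + t • h) h - fderiv ℝ χ (v - t • h) h ≤ 2 * K * ‖h‖ ^ 2 := by
    have a1 : (fderiv ℝ χ (v + t • h) - fderiv ℝ χ (v - t • h)) h ≤
        ‖fderiv ℝ χ (v + t • h) - fderiv ℝ χ (v - t • h)‖ * ‖h‖ :=
      (le_abs_self _).trans
        ((fderiv ℝ χ (v + t • h) - fderiv ℝ χ (v - t • h)).le_opNorm h)
    have a2 : ‖fderiv ℝ χ (v + t • h) - fderiv ℝ χ (v - t • h)‖ ≤ K * (2 * ‖h‖) := by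
      rw [← dist_eq_norm]
      refine (hK.dist_le_mul _ _).trans ?_
      rw [dist_eq_norm]
      have : v + t • h - (v - t • h) = (2 * t) • h := by rw [two_mul, add_smul]; abel
      rw [this, norm_smul, Real.norm_eq_abs, abs_of_pos (by linarith [ht.1])]
      have := ht.2
      gcongr
      linarith
    have a3 := mul_le_mul_of_nonneg_right a2 (norm_nonneg h)
    rw [ContinuousLinearMap.sub_apply] at a1
    nlinarith
  linarith

lemma card_bound {n : ℕ} {F : Finset (EE n)} {k r : ℕ} (hk : 1 ≤ k)
    (hF : ∀ p ∈ F, ‖p‖ ≤ r ∧ ∀ i, ∃ m : ℤ, p i = (m : ℝ) / (k : ℝ)) :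
    F.card ≤ (k * (2 * r + 1)) ^ n := by
  have hk0 : (0 : ℝ) < k := by exact_mod_cast hk
  have h1 : F.card ≤ (Fintype.piFinset fun _ : Fin n =>
      Finset.Icc (-((k * r : ℕ) : ℤ)) ((k * r : ℕ) : ℤ)).card := by
    refine Finset.card_le_card_of_injOn (fun p i => ⌊(k : ℝ) * p i⌋) ?_ ?_
    · intro p hp
      rw [Finset.mem_coe, Fintype.mem_piFinset]
      intro i
      obtain ⟨m, hm⟩ := (hF p hp).2 i
      have e : (k : ℝ) * p i = m := by rw [hm]; field_simp
      have hb : |p i| ≤ r := by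
        have := PiLp.norm_apply_le p i
        rw [Real.norm_eq_abs] at this
        exact this.trans (hF p hp).1
      have hb' := abs_le.1 hb
      beta_reduce
      rw [e, Int.floor_intCast, Finset.mem_Icc]
      constructor
      · have : (-((k * r : ℕ) : ℤ) : ℝ) ≤ (m : ℝ) := by
          rw [← e]; push_cast; nlinarith [hb'.1]
        exact_mod_cast this
      · have : (m : ℝ) ≤ (((k * r : ℕ) : ℤ) : ℝ) := by
          rw [← e]; push_cast; nlinarith [hb'.2]
        exact_mod_cast this
    · intro p hp q hq hpq
      ext i
      obtain ⟨m, hm⟩ := (hF p hp).2 i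
      obtain ⟨m', hm'⟩ := (hF q hq).2 i
      have := congrFun hpq i
      simp only at this
      have e : (k : ℝ) * p i = m := by rw [hm]; field_simp
      have e' : (k : ℝ) * q i = m' := by rw [hm']; field_simp
      rw [e, e', Int.floor_intCast, Int.floor_intCast] at this
      rw [hm, hm', this]
  refine h1.trans ?_
  rw [Fintype.card_piFinset]
  simp only [Int.card_Icc, Finset.prod_const, Finset.card_univ, Fintype.card_fin]
  apply Nat.pow_le_pow_left
  have : (((k * r : ℕ) : ℤ) + 1 - -((k * r : ℕ) : ℤ)).toNat = 2 * (k * r) + 1 := by omega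
  rw [this]
  nlinarith

lemma growth (n r : ℕ) (c : ℝ) :
    Tendsto (fun k : ℕ => (k : ℝ)⁻¹ * (Real.log (((k * (2 * r + 1)) ^ n : ℕ) : ℝ) - Real.log c))
      atTop (nhds 0) := by
  have h1 : Tendsto (fun k : ℕ => Real.log (k : ℝ) / (k : ℝ)) atTop (nhds 0) :=
    Real.isLittleO_log_id_atTop.tendsto_div_nhds_zero.comp tendsto_natCast_atTop_atTop
  have h2 : Tendsto (fun k : ℕ => (k : ℝ)⁻¹) atTop (nhds 0) := tendsto_inv_atTop_nhds_zero_nat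
  have h3 : Tendsto (fun k : ℕ => (n : ℝ) * (Real.log (k : ℝ) / (k : ℝ)) +
      (k : ℝ)⁻¹ * (n * Real.log ((2 * r + 1 : ℕ) : ℝ) - Real.log c)) atTop (nhds 0) := by
    simpa using (h1.const_mul (n : ℝ)).add (h2.mul_const (n * Real.log ((2 * r + 1 : ℕ) : ℝ) - Real.log c))
  refine h3.congr' ?_
  filter_upwards [eventually_ge_atTop 1] with k hk
  have hk0 : (0 : ℝ) < k := by exact_mod_cast hk
  have hr : ((2 * r + 1 : ℕ) : ℝ) ≠ 0 := by positivity
  rw [Nat.cast_pow, Real.log_pow, Nat.cast_mul, Real.log_mul hk0.ne' hr]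
  ring

lemma density {n : ℕ} {U : Set (EE n)} (hU : IsOpen U) (hne : U.Nonempty) :
    ∀ᶠ k : ℕ in atTop, ∃ q ∈ U, ∀ i, ∃ m : ℤ, q i = (m : ℝ) / (k : ℝ) := by
  obtain ⟨q, hq⟩ := hne
  have hlim : Tendsto (fun k : ℕ => WithLp.toLp 2 fun i : Fin n => (⌊(k : ℝ) * q i⌋ : ℝ) / (k : ℝ))
      atTop (nhds q) := by
    have hc : Continuous fun x : Fin n → ℝ => (WithLp.toLp 2 x : EE n) := PiLp.continuous_toLp 2 _
    have h0 : Tendsto (fun k : ℕ => fun i : Fin n => (⌊(k : ℝ) * q i⌋ : ℝ) / (k : ℝ)) atTop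
        (nhds (WithLp.ofLp q)) := by
      rw [tendsto_pi_nhds]
      intro i
      have h1 : Tendsto (fun k : ℕ => q i - (k : ℝ)⁻¹) atTop (nhds (q i)) := by
        simpa using (tendsto_const_nhds (x := q i)).sub (tendsto_inv_atTop_nhds_zero_nat (𝕜 := ℝ))
      refine tendsto_of_tendsto_of_tendsto_of_le_of_le' h1 tendsto_const_nhds ?_ ?_
      · filter_upwards [eventually_ge_atTop 1] with k hk
        have hk0 : (0 : ℝ) < k := by exact_mod_cast hk
        rw [le_div_iff₀ hk0, sub_mul, inv_mul_cancel₀ hk0.ne']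
        linarith [(Int.sub_one_lt_floor ((k : ℝ) * q i))]
      · filter_upwards [eventually_ge_atTop 1] with k hk
        have hk0 : (0 : ℝ) < k := by exact_mod_cast hk
        rw [div_le_iff₀ hk0]
        linarith [Int.floor_le ((k : ℝ) * q i)]
    exact (hc.tendsto _).comp h0
  filter_upwards [hlim.eventually (hU.mem_nhds hq)] with k hk
  exact ⟨_, hk, fun i => ⟨⌊(k : ℝ) * q i⌋, rfl⟩⟩

lemma N_integrable {n : ℕ} {φ D : EE n → ℝ} (hφ : Continuous φ) (hDi : Integrable D)
    {M : ℝ} {p : EE n} (hM : ∀ w, ⟪p, w⟫ - φ w ≤ M) (k : ℕ) :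
    Integrable fun w => Real.exp ((k : ℝ) * (⟪p, w⟫ - φ w)) * D w := by
  refine hDi.bdd_mul (c := Real.exp (k * M)) (by fun_prop) (Eventually.of_forall fun w => ?_)
  rw [Real.norm_eq_abs, Real.abs_exp]
  have := hM w
  gcongr

/-- Uniform lower bound for the norming constants. -/
lemma N_lower {n : ℕ} {Δ : Set (EE n)} (hΔ : IsCompact Δ) {φ D : EE n → ℝ} (hφ : Continuous φ)
    (hD0 : ∀ w, 0 ≤ D w) (hDi : Integrable D)
    (hDb : ∀ v ε, 0 < ε → 0 < ∫ w in Metric.ball v ε, D w)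
    {M : ℝ} (hM : ∀ p ∈ Δ, ∀ w, ⟪p, w⟫ - φ w ≤ M) {v : EE n} {L : ℝ} (hL : convEnv φ v < L) :
    ∃ c > 0, ∀ k : ℕ, ∀ q ∈ Δ, c * Real.exp (k * (⟪q, v⟫ - L)) ≤
      ∫ w, Real.exp ((k : ℝ) * (⟪q, w⟫ - φ w)) * D w := by
  have := IsCompact.induction_on (p := fun s => ∃ c > 0, ∀ k : ℕ, ∀ q ∈ s ∩ Δ,
    c * Real.exp (k * (⟪q, v⟫ - L)) ≤
      ∫ w, Real.exp ((k : ℝ) * (⟪q, w⟫ - φ w)) * D w) hΔ ?_ ?_ ?_ ?_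
  · obtain ⟨c, hc, h⟩ := this
    exact ⟨c, hc, fun k q hq => h k q ⟨hq, hq⟩⟩
  · exact ⟨1, one_pos, fun k q hq => hq.1.elim⟩
  · rintro s t hst ⟨c, hc, h⟩
    exact ⟨c, hc, fun k q hq => h k q ⟨hst hq.1, hq.2⟩⟩
  · rintro s t ⟨c, hc, h⟩ ⟨c', hc', h'⟩
    refine ⟨min c c', lt_min hc hc', fun k q hq => ?_⟩
    rcases hq.1 with hqs | hqt
    · exact le_trans (mul_le_mul_of_nonneg_right (min_le_left _ _) (Real.exp_pos _).le)
        (h k q ⟨hqs, hq.2⟩)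
    · exact le_trans (mul_le_mul_of_nonneg_right (min_le_right _ _) (Real.exp_pos _).le)
        (h' k q ⟨hqt, hq.2⟩)
  · intro p _
    have hw : ∃ w, φ w < L + ⟪p, w - v⟫ := by
      by_contra hc
      push Not at hc
      have := le_convEnv (affine_convex p v L) hc v
      simp only [sub_self, inner_zero_right, add_zero] at this
      linarith
    obtain ⟨w, hw⟩ := hw
    have hopen : IsOpen {x : EE n × EE n | φ x.2 < L + ⟪x.1, x.2 - v⟫} :=
      isOpen_lt (by fun_prop) (by fun_prop)
    have hmem := hopen.mem_nhds (show (p, w) ∈ _ from hw)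
    rw [mem_nhds_prod_iff] at hmem
    obtain ⟨U, hU, W, hW, hUW⟩ := hmem
    obtain ⟨ε, hε, hball⟩ := Metric.mem_nhds_iff.1 hW
    refine ⟨U, mem_nhdsWithin_of_mem_nhds hU, _, hDb w ε hε, fun k q hq => ?_⟩
    have hi := N_integrable hφ hDi (hM q hq.2) k
    calc (∫ x in Metric.ball w ε, D x) * Real.exp (k * (⟪q, v⟫ - L))
        = ∫ x in Metric.ball w ε, Real.exp (k * (⟪q, v⟫ - L)) * D x := by
          rw [integral_const_mul, mul_comm]
      _ ≤ ∫ x in Metric.ball w ε, Real.exp ((k : ℝ) * (⟪q, x⟫ - φ x)) * D x := by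
          refine setIntegral_mono_on (hDi.integrableOn.const_mul _) hi.integrableOn
            measurableSet_ball fun x hx => ?_
          have hx' : φ x < L + ⟪q, x - v⟫ := hUW (Set.mk_mem_prod hq.1 (hball hx))
          rw [inner_sub_right] at hx'
          refine mul_le_mul_of_nonneg_right (Real.exp_le_exp.2 ?_) (hD0 x)
          refine mul_le_mul_of_nonneg_left ?_ (Nat.cast_nonneg k)
          linarith
      _ ≤ _ := setIntegral_le_integral hi
          (Eventually.of_forall fun x => mul_nonneg (Real.exp_pos _).le (hD0 x))

lemma N_upper {n : ℕ} {φ D : EE n → ℝ} (hφ : Continuous φ)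
    (hD0 : ∀ w, 0 ≤ D w) (hDi : Integrable D)
    {q v : EE n} {L : ℝ} (hq : ∀ w, L + ⟪q, w - v⟫ ≤ φ w) (k : ℕ) :
    ∫ w, Real.exp ((k : ℝ) * (⟪q, w⟫ - φ w)) * D w ≤
      Real.exp (k * (⟪q, v⟫ - L)) * ∫ w, D w := by
  have hq' : ∀ w, ⟪q, w⟫ - φ w ≤ ⟪q, v⟫ - L := by
    intro w
    have := hq w
    rw [inner_sub_right] at this
    linarith
  rw [← integral_const_mul]
  refine integral_mono (N_integrable hφ hDi hq' k) (hDi.const_mul _) fun w => ?_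
  refine mul_le_mul_of_nonneg_right (Real.exp_le_exp.2 ?_) (hD0 w)
  exact mul_le_mul_of_nonneg_left (hq' w) (Nat.cast_nonneg k)

lemma pointwise_limit {n : ℕ} {Δ : Set (EE n)} (hΔ : IsCompact Δ) (hΔc : Convex ℝ Δ)
    (hΔint : (interior Δ).Nonempty) {r : ℕ} (hr : ∀ p ∈ Δ, ‖p‖ ≤ r)
    {φ D : EE n → ℝ} (hφ : Continuous φ)
    (hD0 : ∀ w, 0 ≤ D w) (hDi : Integrable D)
    (hDb : ∀ v ε, 0 < ε → 0 < ∫ w in Metric.ball v ε, D w)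
    {M : ℝ} (hM : ∀ p ∈ Δ, ∀ w, ⟪p, w⟫ - φ w ≤ M)
    (hsub : ∀ v, ∃ p ∈ Δ, ∀ w, convEnv φ v + ⟪p, w - v⟫ ≤ φ w)
    (Λ : ℕ → Finset (EE n))
    (hΛ : ∀ k : ℕ, 1 ≤ k → ((Λ k : Set (EE n))
      = Δ ∩ {p | ∀ i, ∃ m : ℤ, p i = (m : ℝ) / (k : ℝ)}))
    (hΛne : ∀ k : ℕ, 1 ≤ k → (Λ k).Nonempty)
    (N : ℕ → EE n → ℝ)
    (hN : ∀ k p, N k p = ∫ w, Real.exp ((k : ℝ) * (⟪p, w⟫ - φ w)) * D w)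
    (hNpos : ∀ k, ∀ p ∈ Δ, 0 < N k p) (v : EE n) :
    Tendsto (fun k : ℕ => (k : ℝ)⁻¹ * Real.log (∑ p ∈ Λ k, Real.exp ((k : ℝ) * ⟪p, v⟫) / N k p))
      atTop (nhds (convEnv φ v)) := by
  have hmem : ∀ k, 1 ≤ k → ∀ p ∈ Λ k, p ∈ Δ ∧ ∀ i, ∃ m : ℤ, p i = (m : ℝ) / (k : ℝ) := by
    intro k hk p hp
    have : p ∈ (Λ k : Set (EE n)) := hp
    rwa [hΛ k hk] at this
  have hterm : ∀ k, 1 ≤ k → ∀ p ∈ Λ k, 0 < Real.exp ((k : ℝ) * ⟪p, v⟫) / N k p := fun k hk p hp =>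
    div_pos (Real.exp_pos _) (hNpos k p (hmem k hk p hp).1)
  rw [tendsto_order]
  constructor
  · intro L hL
    obtain ⟨p, hp, hpsub⟩ := hsub v
    set B := -(r * ‖v‖) - M with hB
    have ht : ∃ t : ℝ, 0 < t ∧ t ≤ 1 ∧ L < (1 - t) * convEnv φ v + t * B := by
      have hc : Continuous fun t : ℝ => (1 - t) * convEnv φ v + t * B := by fun_prop
      have h0 : L < (1 - (0:ℝ)) * convEnv φ v + 0 * B := by simpa using hL
      have he := hc.continuousAt.eventually (lt_mem_nhds h0)
      obtain ⟨ε, hε, hball⟩ := Metric.eventually_nhds_iff.1 he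
      refine ⟨min (ε / 2) 1, lt_min (by positivity) one_pos, min_le_right _ _, hball ?_⟩
      rw [Real.dist_eq, sub_zero, abs_of_pos (lt_min (by positivity) one_pos)]
      exact (min_le_left _ _).trans_lt (by linarith)
    obtain ⟨t, ht0, ht1, htL⟩ := ht
    set L₁ := (1 - t) * convEnv φ v + t * B with hL₁
    set U : Set (EE n) := {q | t⁻¹ • (q - (1 - t) • p) ∈ interior Δ} with hU
    have hUo : IsOpen U := isOpen_interior.preimage (by fun_prop)
    have hUne : U.Nonempty := by
      obtain ⟨q₀, hq₀⟩ := hΔint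
      refine ⟨(1 - t) • p + t • q₀, ?_⟩
      change t⁻¹ • ((1 - t) • p + t • q₀ - (1 - t) • p) ∈ interior Δ
      rwa [add_sub_cancel_left, inv_smul_smul₀ ht0.ne']
    have hUq : ∀ q ∈ U, q ∈ Δ ∧ ∀ w, L₁ + ⟪q, w - v⟫ ≤ φ w := by
      intro q hq
      set q₀ := t⁻¹ • (q - (1 - t) • p) with hq₀
      have hq₀Δ : q₀ ∈ Δ := interior_subset hq
      have e : q = (1 - t) • p + t • q₀ := by
        rw [hq₀, smul_inv_smul₀ ht0.ne']; abel
      refine ⟨?_, fun w => ?_⟩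
      · rw [e]
        exact hΔc hp hq₀Δ (by linarith) ht0.le (by ring)
      · have a1 := hpsub w
        have a2 := hM q₀ hq₀Δ w
        have a3 : -(r * ‖v‖) ≤ ⟪q₀, v⟫ := by
          have := abs_le.1 ((abs_real_inner_le_norm q₀ v).trans
            (mul_le_mul_of_nonneg_right (hr q₀ hq₀Δ) (norm_nonneg v)))
          exact this.1
        rw [e, inner_add_left, real_inner_smul_left, real_inner_smul_left, inner_sub_right q₀]
        have b1 := mul_le_mul_of_nonneg_left a1 (sub_nonneg.2 ht1)
        have b2 := mul_le_mul_of_nonneg_left a2 ht0.le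
        have b3 := mul_le_mul_of_nonneg_left a3 ht0.le
        rw [hL₁, hB]
        nlinarith
    set V := ∫ w, D w with hV
    have hVpos : 0 < V := (hDb v 1 one_pos).trans_le
      (setIntegral_le_integral hDi (Eventually.of_forall hD0))
    have hlim : Tendsto (fun k : ℕ => L₁ - (k : ℝ)⁻¹ * Real.log V) atTop (nhds L₁) := by
      simpa using (tendsto_const_nhds (x := L₁)).sub
        ((tendsto_inv_atTop_nhds_zero_nat (𝕜 := ℝ)).mul_const (Real.log V))
    filter_upwards [density hUo hUne, hlim.eventually (lt_mem_nhds htL), eventually_ge_atTop 1]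
      with k hk hkL hk1
    have hk0 : (0 : ℝ) < k := by exact_mod_cast hk1
    obtain ⟨q, hqU, hqk⟩ := hk
    obtain ⟨hqΔ, hqφ⟩ := hUq q hqU
    have hqΛ : q ∈ Λ k := by
      have : q ∈ (Λ k : Set (EE n)) := by rw [hΛ k hk1]; exact ⟨hqΔ, hqk⟩
      exact this
    refine hkL.trans_le ?_
    have h1 : N k q ≤ Real.exp (k * (⟪q, v⟫ - L₁)) * V := by
      rw [hN]; exact N_upper hφ hD0 hDi hqφ k
    have h2 : Real.exp (k * L₁) / V ≤ Real.exp ((k : ℝ) * ⟪q, v⟫) / N k q := by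
      rw [div_le_div_iff₀ hVpos (hNpos k q hqΔ)]
      refine (mul_le_mul_of_nonneg_left h1 (Real.exp_pos _).le).trans (le_of_eq ?_)
      rw [← mul_assoc, ← Real.exp_add]
      congr 2
      ring
    have h3 := h2.trans (Finset.single_le_sum (fun p hp => (hterm k hk1 p hp).le) hqΛ)
    have h4 := Real.log_le_log (by positivity) h3
    rw [Real.log_div (Real.exp_pos _).ne' hVpos.ne', Real.log_exp] at h4
    have h5 := mul_le_mul_of_nonneg_left h4 (inv_pos.2 hk0).le
    rwa [mul_sub, inv_mul_cancel_left₀ hk0.ne'] at h5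
  · intro L hL
    obtain ⟨L', hL'1, hL'2⟩ := exists_between hL
    obtain ⟨c, hc, hcN⟩ := N_lower hΔ hφ hD0 hDi hDb hM hL'1
    have hlim := (growth n r c).const_add L'
    rw [add_zero] at hlim
    filter_upwards [hlim.eventually (gt_mem_nhds hL'2), eventually_ge_atTop 1] with k hkL hk1
    have hk0 : (0 : ℝ) < k := by exact_mod_cast hk1
    refine lt_of_le_of_lt ?_ hkL
    have h1 : ∀ p ∈ Λ k, Real.exp ((k : ℝ) * ⟪p, v⟫) / N k p ≤ Real.exp (k * L') / c := by
      intro p hp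
      rw [div_le_div_iff₀ (hNpos k p (hmem k hk1 p hp).1) hc]
      have := hcN k p (hmem k hk1 p hp).1
      rw [← hN] at this
      refine le_trans (le_of_eq ?_) (mul_le_mul_of_nonneg_left this (Real.exp_pos _).le)
      rw [mul_left_comm, ← Real.exp_add, mul_comm]
      congr 2
      ring
    have h2 := Finset.sum_le_card_nsmul _ _ _ h1
    have hcard := card_bound (r := r) hk1 fun p hp => ⟨hr p (hmem k hk1 p hp).1, (hmem k hk1 p hp).2⟩
    set Q := (k * (2 * r + 1)) ^ n with hQ
    have hQpos : 0 < (Q : ℝ) := by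
      rw [hQ]; push_cast; positivity
    have h3 : ∑ p ∈ Λ k, Real.exp ((k : ℝ) * ⟪p, v⟫) / N k p ≤ Q * (Real.exp (k * L') / c) := by
      refine h2.trans ?_
      rw [nsmul_eq_mul]
      gcongr
    have h4 := Real.log_le_log (Finset.sum_pos (hterm k hk1) (hΛne k hk1)) h3
    rw [Real.log_mul hQpos.ne' (by positivity), Real.log_div (Real.exp_pos _).ne' hc.ne',
      Real.log_exp] at h4
    have h5 := mul_le_mul_of_nonneg_left h4 (inv_pos.2 hk0).le
    have h6 : (k : ℝ)⁻¹ * (Real.log Q + (k * L' - Real.log c)) =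
        L' + (k : ℝ)⁻¹ * (Real.log Q - Real.log c) := by
      field_simp
      ring
    rwa [h6] at h5

lemma inner_le_logsum {n : ℕ} {S A : Finset (EE n)} (hSA : ∀ s ∈ S, s ∈ A) {p : EE n}
    (hp : p ∈ convexHull ℝ (S : Set (EE n))) (w : EE n) :
    ⟪p, w⟫ ≤ Real.log (∑ α ∈ A, Real.exp ⟪α, w⟫) := by
  have hconv : Convex ℝ {p : EE n | ⟪p, w⟫ ≤ Real.log (∑ α ∈ A, Real.exp ⟪α, w⟫)} := by
    intro x hx y hy a b ha hb hab
    simp only [Set.mem_setOf_eq] at hx hy ⊢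
    rw [inner_add_left, real_inner_smul_left, real_inner_smul_left]
    have : b = 1 - a := by linarith
    subst this
    nlinarith
  refine convexHull_min ?_ hconv hp
  intro s hs
  have h1 : Real.exp ⟪s, w⟫ ≤ ∑ α ∈ A, Real.exp ⟪α, w⟫ :=
    Finset.single_le_sum (f := fun α => Real.exp ⟪α, w⟫) (fun i _ => (Real.exp_pos _).le)
      (hSA s hs)
  have h2 := Real.log_le_log (Real.exp_pos _) h1
  rwa [Real.log_exp] at h2

lemma span_of_interior {n : ℕ} {S A : Finset (EE n)} (hSA : ∀ s ∈ S, s ∈ A)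
    (hInt : (interior (convexHull ℝ (S : Set (EE n)))).Nonempty) (h : EE n) (m : ℝ)
    (hm : ∀ p ∈ A, ⟪p, h⟫ = m) : h = 0 := by
  have hconv : Convex ℝ {p : EE n | ⟪p, h⟫ = m} := by
    intro x hx y hy a b ha hb hab
    simp only [Set.mem_setOf_eq] at hx hy ⊢
    rw [inner_add_left, real_inner_smul_left, real_inner_smul_left, hx, hy, ← add_mul, hab,
      one_mul]
  have hsub : convexHull ℝ (S : Set (EE n)) ⊆ {p : EE n | ⟪p, h⟫ = m} :=
    convexHull_min (fun s hs => hm s (hSA s hs)) hconv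
  obtain ⟨p₀, hp₀⟩ := hInt
  have hlim : Tendsto (fun t : ℝ => p₀ + t • h) (nhds 0) (nhds p₀) := by
    have : Continuous fun t : ℝ => p₀ + t • h := by fun_prop
    simpa using this.tendsto 0
  have hev := hlim.eventually (isOpen_interior.mem_nhds hp₀)
  obtain ⟨ε, hε, hb⟩ := Metric.eventually_nhds_iff.1 hev
  have h1 : p₀ + (ε / 2) • h ∈ {p : EE n | ⟪p, h⟫ = m} := by
    refine hsub (interior_subset (hb ?_))
    rw [Real.dist_eq, sub_zero, abs_of_pos (by positivity)]
    linarith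
  have h2 : p₀ ∈ {p : EE n | ⟪p, h⟫ = m} := hsub (interior_subset hp₀)
  simp only [Set.mem_setOf_eq] at h1 h2
  rw [inner_add_left, h2, real_inner_smul_left] at h1
  have h3 : (ε / 2) * ⟪h, h⟫ = 0 := by linarith
  rcases mul_eq_zero.1 h3 with h4 | h4
  · linarith
  · exact inner_self_eq_zero.1 h4

/-- An affine minorant of `φ_Δ + bounded` has its slope in `Δ`. -/
lemma slope_mem {n : ℕ} {Δ : Set (EE n)} (hΔ : IsClosed Δ) (hΔc : Convex ℝ Δ)
    {A : Finset (EE n)} (hA : ∀ a ∈ A, a ∈ Δ) (hAne : A.Nonempty) {φ : EE n → ℝ} {M : ℝ}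
    (hφ : ∀ w, φ w ≤ Real.log (∑ α ∈ A, Real.exp ⟪α, w⟫) + M) {p v : EE n} {b : ℝ}
    (hp : ∀ w, b + ⟪p, w - v⟫ ≤ φ w) : p ∈ Δ := by
  by_contra hpΔ
  obtain ⟨f, u, hf1, hf2⟩ := geometric_hahn_banach_closed_point hΔc hΔ hpΔ
  set y := (InnerProductSpace.toDual ℝ (EE n)).symm f with hy
  have hfy : ∀ x, f x = ⟪x, y⟫ := fun x => by
    rw [real_inner_comm, hy, InnerProductSpace.toDual_symm_apply]
  rw [hfy] at hf2
  have hcard : (0 : ℝ) < A.card := by exact_mod_cast hAne.card_pos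
  have hup : ∀ t : ℝ, 0 ≤ t → Real.log (∑ α ∈ A, Real.exp ⟪α, t • y⟫) ≤
      Real.log A.card + t * u := by
    intro t ht
    have h1 : ∑ α ∈ A, Real.exp ⟪α, t • y⟫ ≤ A.card * Real.exp (t * u) := by
      rw [← nsmul_eq_mul]
      refine Finset.sum_le_card_nsmul _ _ _ fun a ha => Real.exp_le_exp.2 ?_
      have := hf1 a (hA a ha)
      rw [hfy] at this
      rw [real_inner_smul_right]
      exact mul_le_mul_of_nonneg_left this.le ht
    have h2 := Real.log_le_log (Finset.sum_pos (fun a _ => Real.exp_pos _) hAne) h1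
    rwa [Real.log_mul hcard.ne' (Real.exp_pos _).ne', Real.log_exp] at h2
  have hall : ∀ t : ℝ, 0 ≤ t → t * (⟪p, y⟫ - u) ≤ Real.log A.card + M - b + ⟪p, v⟫ := by
    intro t ht
    have h1 := hp (t • y)
    have h2 := hφ (t • y)
    have h3 := hup t ht
    rw [inner_sub_right, real_inner_smul_right] at h1
    linarith
  have hd : 0 < ⟪p, y⟫ - u := by linarith
  set K := Real.log A.card + M - b + ⟪p, v⟫
  have h1 := hall ((|K| + 1) / (⟪p, y⟫ - u)) (by positivity)
  rw [div_mul_cancel₀ _ hd.ne'] at h1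
  linarith [le_abs_self K]

/-- toric model of the weak convergence of the Bergman volume forms
`(dd^c(k^{−1} log K_k))^n/n! → μ_φ`. With `φ = φ_Δ + χ` as in the toric setup and
`u_k(v) = k^{−1} log( ∑_{p ∈ Λ_k} e^{k⟨p,v⟩}/N_{k,p} )`, for every continuous compactly
supported `f : ℝⁿ → ℝ` one has
`∫ f det(D²u_k) → ∫ f MA[φ_e]` as `k → ∞`, where `MA[φ_e](v) = det(D(∇φ_e)(v))` is the
(almost everywhere defined) Monge–Ampère density of the convex envelope `φ_e`
(`fderiv` taking the junk value `0`, of vanishing determinant since `n ≥ 1`, at points of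
non-differentiability). -/
theorem bergman_volume_forms_weak_convergence_toric (n : ℕ) (hn : 1 ≤ n)
    (S : Finset (EuclideanSpace ℝ (Fin n)))
    (hS : ∀ α ∈ S, ∀ i, ∃ m : ℤ, α i = (m : ℝ))
    (Δ : Set (EuclideanSpace ℝ (Fin n)))
    (hΔ : Δ = convexHull ℝ (S : Set (EuclideanSpace ℝ (Fin n))))
    (hΔint : (interior Δ).Nonempty)
    (A : Finset (EuclideanSpace ℝ (Fin n)))
    (hA : (A : Set (EuclideanSpace ℝ (Fin n))) = Δ ∩ {v | ∀ i, ∃ m : ℤ, v i = (m : ℝ)})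
    (φΔ χ φ : EuclideanSpace ℝ (Fin n) → ℝ)
    (hφΔ : ∀ v, φΔ v = Real.log (∑ α ∈ A, Real.exp ⟪α, v⟫))
    (hχ : ContDiff ℝ (⊤ : ℕ∞) χ) (hχc : HasCompactSupport χ)
    (hφ : φ = φΔ + χ)
    (Λ : ℕ → Finset (EuclideanSpace ℝ (Fin n)))
    (hΛ : ∀ k : ℕ, 1 ≤ k → ((Λ k : Set (EuclideanSpace ℝ (Fin n)))
      = Δ ∩ {p | ∀ i, ∃ m : ℤ, p i = (m : ℝ) / (k : ℝ)}))
    (N : ℕ → EuclideanSpace ℝ (Fin n) → ℝ)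
    (hN : ∀ k p, N k p
      = ∫ w, Real.exp ((k : ℝ) * (⟪p, w⟫ - φ w)) * (fderiv ℝ (gradient φΔ) w).det)
    (u : ℕ → EuclideanSpace ℝ (Fin n) → ℝ)
    (hu : ∀ k v, u k v
      = (k : ℝ)⁻¹ * Real.log (∑ p ∈ Λ k, Real.exp ((k : ℝ) * ⟪p, v⟫) / N k p)) :
    ∀ f : EuclideanSpace ℝ (Fin n) → ℝ, Continuous f → HasCompactSupport f →
      Tendsto (fun k : ℕ => ∫ v, f v * (fderiv ℝ (gradient (u k)) v).det) atTop
        (nhds (∫ v, f v * (fderiv ℝ (gradient (convEnv φ)) v).det)) := by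
  subst hΔ
  set Δ : Set (EE n) := convexHull ℝ (S : Set (EE n)) with hΔdef
  have hcomp : IsCompact Δ := S.finite_toSet.isCompact_convexHull (𝕜 := ℝ)
  have hconv : Convex ℝ Δ := convex_convexHull ℝ _
  have hSΔ : ∀ s ∈ S, s ∈ Δ := fun s hs => subset_convexHull ℝ _ hs
  have hSne : S.Nonempty := by
    rw [Finset.nonempty_iff_ne_empty]
    rintro rfl
    simp [hΔdef] at hΔint
  have hSA : ∀ s ∈ S, s ∈ A := fun s hs => by
    have : s ∈ (A : Set (EE n)) := by rw [hA]; exact ⟨hSΔ s hs, hS s hs⟩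
    exact this
  have hAΔ : ∀ a ∈ A, a ∈ Δ := fun a ha => by
    have : a ∈ (A : Set (EE n)) := ha
    rw [hA] at this
    exact this.1
  have hAne : A.Nonempty := hSne.imp fun s hs => hSA s hs
  have hΛΔ : ∀ k, 1 ≤ k → ∀ p ∈ Λ k, p ∈ Δ := fun k hk p hp => by
    have : p ∈ (Λ k : Set (EE n)) := hp
    rw [hΛ k hk] at this
    exact this.1
  have hΛne : ∀ k, 1 ≤ k → (Λ k).Nonempty := by
    intro k hk
    obtain ⟨s, hs⟩ := hSne
    have hk0 : (0 : ℝ) < k := by exact_mod_cast hk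
    have : s ∈ (Λ k : Set (EE n)) := by
      rw [hΛ k hk]
      refine ⟨hSΔ s hs, fun i => ?_⟩
      obtain ⟨m, hm⟩ := hS s hs i
      refine ⟨m * k, ?_⟩
      rw [hm]
      push_cast
      field_simp
    exact ⟨s, this⟩
  obtain ⟨r, hr0, hr⟩ : ∃ r : ℕ, 0 < (r : ℝ) ∧ ∀ p ∈ Δ, ‖p‖ ≤ r := by
    obtain ⟨C, hC⟩ := hcomp.isBounded.exists_norm_le
    refine ⟨⌈C⌉₊ + 1, by positivity, fun p hp => (hC p hp).trans ?_⟩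
    push_cast
    linarith [Nat.le_ceil C]
  -- the model potential
  have hnΔ : Nice φΔ (lseP A (fun _ => 1) 1) (2 * 1 * (r : ℝ) ^ 2) r := by
    have h := lse_nice (F := A) (c := fun _ => 1) (κ := 1) (R := (r : ℝ)) (fun _ _ => one_pos)
      hAne (fun p hp => hr p (hAΔ p hp)) one_pos
    have e : φΔ = fun v => (1 : ℝ)⁻¹ * Real.log (lseZ A (fun _ => 1) 1 v) := by
      ext v
      simp [hφΔ, lseZ]
    rw [e]
    exact h
  have hinj : Function.Injective (lseP A (fun _ => 1) 1) :=
    lse_inj (fun _ _ => one_pos) hAne (fun h m hm => span_of_interior hSA hΔint h m hm)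
  rw [hnΔ.gradient_eq] at hN
  set D : EE n → ℝ := fun w => (fderiv ℝ (lseP A (fun _ => 1) 1) w).det with hD
  have hD0 : ∀ w, 0 ≤ D w := hnΔ.det_nonneg
  have hDi : Integrable D := hnΔ.integrable_det hn
  have hDb : ∀ v ε, 0 < ε → 0 < ∫ w in Metric.ball v ε, D w := fun v ε hε =>
    hnΔ.ball_pos hn hr0 hinj v hε
  -- the perturbation
  obtain ⟨M, hM⟩ := hχ.continuous.bounded_above_of_compact_support hχc
  have hMa : ∀ w, -M ≤ χ w ∧ χ w ≤ M := fun w => abs_le.1 (hM w)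
  have hφv : ∀ w, φ w = φΔ w + χ w := fun w => by rw [hφ]; rfl
  have hφcont : Continuous φ := by rw [hφ]; exact hnΔ.continuous.add hχ.continuous
  have hMle : ∀ p ∈ Δ, ∀ w, ⟪p, w⟫ - φ w ≤ M := by
    intro p hp w
    have h1 := inner_le_logsum hSA hp w
    rw [← hφΔ] at h1
    rw [hφv]
    linarith [(hMa w).1]
  obtain ⟨s₀, hs₀⟩ := hSne
  have hcv := affine_convex s₀ 0 (-M)
  have hle : ∀ w, -M + ⟪s₀, w - 0⟫ ≤ φ w := fun w => by
    have := hMle s₀ (hSΔ s₀ hs₀) w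
    rw [sub_zero]
    linarith
  obtain ⟨Cχ, hCχ⟩ := chi_sd hχ hχc
  have hsd : ∀ v h, φ (v + h) + φ (v - h) - 2 * φ v ≤
      (2 * 1 * (r : ℝ) ^ 2 + Cχ) * ‖h‖ ^ 2 := by
    intro v h
    have h1 := hnΔ.2.1 v h
    have h2 := hCχ v h
    rw [hφv, hφv, hφv]
    linarith
  -- subgradients of the envelope
  have hEle : ∀ w, convEnv φ w ≤ φ w := convEnv_le hcv hle
  choose Pe hPe using exists_subgrad (convEnv_convex hcv hle)
  have hPe' : ∀ v w, convEnv φ v + ⟪Pe v, w - v⟫ ≤ φ w := fun v w => (hPe v w).trans (hEle w)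
  have hPeΔ : ∀ v, Pe v ∈ Δ := fun v =>
    slope_mem (M := M) hcomp.isClosed hconv hAΔ hAne (fun w => by
      rw [← hφΔ, hφv]
      linarith [(hMa w).2]) (hPe' v)
  have hnE : Nice (convEnv φ) Pe (2 * 1 * (r : ℝ) ^ 2 + Cχ) r :=
    ⟨hPe, convEnv_sd hcv hle hsd, fun v => hr _ (hPeΔ v)⟩
  have hNpos : ∀ k, ∀ p ∈ Δ, 0 < N k p := by
    intro k p hp
    obtain ⟨c, hc, h⟩ := N_lower hcomp hφcont hD0 hDi hDb hMle (v := 0)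
      (L := convEnv φ 0 + 1) (by linarith)
    rw [hN]
    exact lt_of_lt_of_le (mul_pos hc (Real.exp_pos _)) (h k p hp)
  have hlim := pointwise_limit hcomp hconv hΔint hr hφcont hD0 hDi hDb hMle
    (fun v => ⟨Pe v, hPeΔ v, hPe' v⟩) Λ hΛ hΛne N hN hNpos
  have hnu : ∀ k : ℕ, 1 ≤ k → Nice (u k) (gradient (u k)) (2 * (k : ℝ) * (r : ℝ) ^ 2) r := by
    intro k hk
    have hk0 : (0 : ℝ) < k := by exact_mod_cast hk
    have h := lse_nice (F := Λ k) (c := fun p => (N k p)⁻¹) (κ := (k : ℝ)) (R := (r : ℝ))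
      (fun p hp => inv_pos.2 (hNpos k p (hΛΔ k hk p hp))) (hΛne k hk)
      (fun p hp => hr p (hΛΔ k hk p hp)) hk0
    have e : u k = fun v => (k : ℝ)⁻¹ * Real.log (lseZ (Λ k) (fun p => (N k p)⁻¹) k v) := by
      ext v
      rw [hu, lseZ]
      congr 2
      refine Finset.sum_congr rfl fun p _ => ?_
      rw [div_eq_inv_mul]
    rw [← e] at h
    have h' := h
    rwa [← h.gradient_eq] at h'
  intro f hf hfc
  rw [hnE.gradient_eq]
  refine weak_conv hn (g := u) (P := fun k => gradient (u k))
    (C := fun k => 2 * (k : ℝ) * (r : ℝ) ^ 2) hr0 ?_ hnE ?_ hf hfc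
  · filter_upwards [eventually_ge_atTop 1] with k hk using hnu k hk
  · intro v
    simp only [hu]
    exact hlim v
end

section
/- Let Δ ⊂ ℝ^n (n ≥ 1) be the convex hull of a finite subset of ℤ^n with nonempty interior, φ_Δ(v) = log(Σ_{α ∈ Δ∩ℤ^n} e^{⟨α,v⟩}), χ : ℝ^n → ℝ smooth with compact support, φ = φ_Δ + χ, and φ_e the convex envelope of φ. Then lim_{k→∞} k^{−n} · card( Δ ∩ (k^{−1}ℤ)^n ) exists and equals ∫_{ℝ^n} MA[φ_e](v) dv, and both are equal to vol_n(Δ). (This is the toric-model instance of the corollary that the volume of a line bundle, Vol(L) = lim k^{−n} dim H^0(X, L^k), equals the total mass of the equilibrium measure μ_φ.) -/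
open scoped RealInnerProductSpace
open MeasureTheory Filter

namespace ToricVol

section general
variable {n : ℕ}

local notation "𝔼" => EuclideanSpace ℝ (Fin n)

/-- Existence of subgradients of a convex function. -/
lemma exists_subgradient {u : 𝔼 → ℝ} (hu : ConvexOn ℝ Set.univ u) (x : 𝔼) :
    ∃ p : 𝔼, ∀ y, u x + ⟪p, y - x⟫ ≤ u y := by
  have hc : Continuous u := hu.locallyLipschitz.continuous
  have ho : IsOpen {q : 𝔼 × ℝ | q.1 ∈ Set.univ ∧ u q.1 < q.2} := by
    simp only [Set.mem_univ, true_and]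
    exact isOpen_lt (hc.comp continuous_fst) continuous_snd
  obtain ⟨f, hf⟩ := geometric_hahn_banach_open_point (x := ((x, u x) : 𝔼 × ℝ))
    hu.convex_strict_epigraph ho (by simp)
  -- f (y, t) = l y + t * c
  have hsplit : ∀ (y : 𝔼) (t : ℝ), f (y, t) = f (y, 0) + t * f (0, 1) := by
    intro y t
    have : ((y, t) : 𝔼 × ℝ) = (y, 0) + t • ((0, 1) : 𝔼 × ℝ) := by simp
    rw [this, map_add, map_smul, smul_eq_mul]
  have hlt : ∀ (y : 𝔼) (t : ℝ), u y < t → f (y, 0) + t * f (0, 1) < f (x, 0) + u x * f (0, 1) := by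
    intro y t h
    rw [← hsplit, ← hsplit]
    exact hf (y, t) ⟨Set.mem_univ _, h⟩
  set c := f (0, 1) with hcdef
  have hcneg : c < 0 := by
    have := hlt x (u x + 1) (by linarith)
    nlinarith
  have hle : ∀ y, f (y, 0) + u y * c ≤ f (x, 0) + u x * c := by
    intro y
    apply le_of_forall_pos_lt_add
    intro ε hε
    have := hlt y (u y + ε / (-c)) (by have : 0 < ε / (-c) := div_pos hε (by linarith)
                                       linarith)
    have h2 : ε / (-c) * c = -ε := by rw [div_neg, neg_mul, div_mul_cancel₀ _ hcneg.ne]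
    nlinarith
  let l : 𝔼 →L[ℝ] ℝ := (-c)⁻¹ • (f.comp (ContinuousLinearMap.inl ℝ 𝔼 ℝ))
  refine ⟨(InnerProductSpace.toDual ℝ 𝔼).symm l, fun y => ?_⟩
  rw [InnerProductSpace.toDual_symm_apply, map_sub]
  have hl : ∀ z, l z = (-c)⁻¹ * f (z, 0) := fun z => by simp [l]
  rw [hl, hl]
  have hp : 0 < (-c)⁻¹ := inv_pos.mpr (by linarith)
  have h3 : (-c)⁻¹ * (-c) = 1 := inv_mul_cancel₀ (by linarith)
  have := mul_le_mul_of_nonneg_left (hle y) hp.le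
  have e1 : (-c)⁻¹ * (f (y, 0) + u y * c) = (-c)⁻¹ * f (y, 0) - u y := by linear_combination (-u y) * h3
  have e2 : (-c)⁻¹ * (f (x, 0) + u x * c) = (-c)⁻¹ * f (x, 0) - u x := by linear_combination (-u x) * h3
  linarith

/-- convex + semiconcave: quadratic upper bound and gradient. -/
lemma regular {u : 𝔼 → ℝ} (hu : ConvexOn ℝ Set.univ u) {C : ℝ} 
    (hC : ∀ x h, u (x + h) + u (x - h) - 2 * u x ≤ C * ‖h‖ ^ 2) (x : 𝔼) :
    HasGradientAt u (gradient u x) x ∧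
    (∀ y, u x + ⟪gradient u x, y - x⟫ ≤ u y) ∧
    (∀ y, u y ≤ u x + ⟪gradient u x, y - x⟫ + C * ‖y - x‖ ^ 2) := by
  obtain ⟨p, hp⟩ := exists_subgradient hu x
  have hup : ∀ y, u y ≤ u x + ⟪p, y - x⟫ + C * ‖y - x‖ ^ 2 := by
    intro y
    have h1 := hC x (y - x)
    have h2 := hp (x - (y - x))
    have h3 : x - (y - x) - x = -(y - x) := by abel
    rw [h3, inner_neg_right] at h2
    rw [add_sub_cancel] at h1
    linarith
  have hg : HasGradientAt u p x := by
    rw [hasGradientAt_iff_isLittleO]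
    have hO : (fun y => u y - u x - ⟪p, y - x⟫) =O[nhds x] fun y => ‖y - x‖ ^ 2 := by
      refine Asymptotics.IsBigO.of_bound C (Eventually.of_forall fun y => ?_)
      have h1 := hp y
      have h2 := hup y
      rw [Real.norm_of_nonneg (by linarith), Real.norm_of_nonneg (by positivity)]
      linarith
    refine hO.trans_isLittleO ?_
    exact Asymptotics.isLittleO_pow_sub_sub x one_lt_two
  rw [hg.gradient]
  exact ⟨hg, hp, hup⟩

lemma gradient_lipschitz {u : 𝔼 → ℝ} (hu : ConvexOn ℝ Set.univ u) {C : ℝ} (hC0 : 0 ≤ C)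
    (hC : ∀ x h, u (x + h) + u (x - h) - 2 * u x ≤ C * ‖h‖ ^ 2) :
    LipschitzWith (Real.toNNReal (4 * C)) (gradient u) := by
  apply LipschitzWith.of_dist_le_mul
  intro y x
  rw [Real.coe_toNNReal _ (by positivity), dist_eq_norm, dist_eq_norm]
  obtain ⟨-, hlx, hux⟩ := regular hu hC x
  obtain ⟨-, hly, huy⟩ := regular hu hC y
  set p := gradient u x
  set q := gradient u y
  by_cases hd : q - p = 0
  · rw [hd, norm_zero]; positivity
  have hdpos : 0 < ‖q - p‖ := norm_pos_iff.mpr hd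
  set t := ‖y - x‖ / ‖q - p‖ with ht
  have ht0 : 0 ≤ t := by positivity
  set z := y + t • (q - p) with hz
  have h1 := hly z
  have h2 := hux z
  have h3 := hlx y
  have hzy : z - y = t • (q - p) := by simp [hz]
  have hzx : z - x = (y - x) + t • (q - p) := by rw [hz]; abel
  have hn : ‖z - x‖ ≤ 2 * ‖y - x‖ := by
    rw [hzx]
    refine (norm_add_le _ _).trans ?_
    rw [norm_smul, Real.norm_of_nonneg ht0, ht, div_mul_cancel₀ _ hdpos.ne']
    linarith
  have h4 : t * ‖q - p‖ ^ 2 ≤ C * ‖z - x‖ ^ 2 := by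
    have : ⟪q - p, t • (q - p)⟫ = t * ‖q - p‖ ^ 2 := by
      rw [real_inner_smul_right, real_inner_self_eq_norm_sq]
    rw [← this, ← hzy, inner_sub_left]
    have e : ⟪p, z - x⟫ = ⟪p, y - x⟫ + ⟪p, z - y⟫ := by rw [← inner_add_right]; congr 1; abel
    linarith
  have h5 : t * ‖q - p‖ ^ 2 = ‖y - x‖ * ‖q - p‖ := by
    rw [ht]; field_simp
  have h6 : ‖z - x‖ ^ 2 ≤ (2 * ‖y - x‖) ^ 2 := by gcongr
  have h7 : ‖y - x‖ * ‖q - p‖ ≤ ‖y - x‖ * (4 * C * ‖y - x‖) := by nlinarith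
  rcases (norm_nonneg (y - x)).eq_or_lt with h0 | h0
  · have : y = x := by
      rw [← sub_eq_zero]; exact norm_eq_zero.mp h0.symm
    exact absurd (by simp [p, q, this]) hd
  · exact le_of_mul_le_mul_left h7 h0

/-- A linear map with nonnegative quadratic form has nonnegative determinant. -/
lemma det_nonneg_of_monotone (A : 𝔼 →L[ℝ] 𝔼) (hA : ∀ h, 0 ≤ ⟪A h, h⟫) : 0 ≤ A.det := by
  let B : ℝ → 𝔼 →L[ℝ] 𝔼 := fun s => (1 - s) • ContinuousLinearMap.id ℝ 𝔼 + s • A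
  have hB : Continuous fun s => (B s).det := by
    refine ContinuousLinearMap.continuous_det.comp ?_
    fun_prop
  have hne : ∀ s, 0 ≤ s → s < 1 → (B s).det ≠ 0 := by
    intro s hs hs1 h0
    obtain ⟨v, hv, hv0⟩ := (LinearMap.bot_lt_ker_of_det_eq_zero (f := (B s : 𝔼 →ₗ[ℝ] 𝔼)) h0 |> 
      fun h => (Submodule.ne_bot_iff _).mp h.ne')
    have hv' : B s v = 0 := hv
    have : ⟪B s v, v⟫ = (1 - s) * ‖v‖ ^ 2 + s * ⟪A v, v⟫ := by
      simp [B, inner_add_left, real_inner_smul_left]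
    rw [hv', inner_zero_left] at this
    have h1 : 0 < ‖v‖ ^ 2 := by have := norm_pos_iff.mpr hv0; positivity
    have := hA v
    nlinarith [mul_nonneg hs this, mul_pos (sub_pos.mpr hs1) h1]
  have hB0 : (B 0).det = 1 := by
    simp [B, ContinuousLinearMap.det]
  have hpos : ∀ s, 0 ≤ s → s < 1 → 0 ≤ (B s).det := by
    intro s hs hs1
    by_contra hneg
    push Not at hneg
    obtain ⟨t, ht, ht0⟩ := intermediate_value_Icc' hs hB.continuousOn
      (show (0 : ℝ) ∈ Set.Icc ((B s).det) ((B 0).det) from ⟨hneg.le, by rw [hB0]; norm_num⟩)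
    exact hne t ht.1 (ht.2.trans_lt hs1) ht0
  have hB1 : (B 1).det = A.det := by
    have : B 1 = A := by ext1 v; simp [B]
    rw [this]
  rw [← hB1]
  have : Tendsto (fun s => (B s).det) (nhdsWithin 1 (Set.Iio 1)) (nhds (B 1).det) :=
    (hB.tendsto 1).mono_left nhdsWithin_le_nhds
  refine ge_of_tendsto this ?_
  filter_upwards [Ioo_mem_nhdsLT (show (0:ℝ) < 1 by norm_num)] with s hs
  exact hpos s hs.1.le hs.2

lemma fderiv_monotone {G : 𝔼 → 𝔼} (hG : ∀ x y, 0 ≤ ⟪G y - G x, y - x⟫) {x : 𝔼}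
    (hd : DifferentiableAt ℝ G x) (h : 𝔼) : 0 ≤ ⟪fderiv ℝ G x h, h⟫ := by
  have h1 : HasLineDerivAt ℝ G (fderiv ℝ G x h) x h := hd.hasFDerivAt.hasLineDerivAt h
  have h2 := h1.tendsto_slope_zero_right
  have h3 : Tendsto (fun t : ℝ => ⟪t⁻¹ • (G (x + t • h) - G x), h⟫) (nhdsWithin 0 (Set.Ioi 0))
      (nhds ⟪fderiv ℝ G x h, h⟫) := h2.inner tendsto_const_nhds
  refine ge_of_tendsto h3 ?_
  filter_upwards [self_mem_nhdsWithin] with t ht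
  have ht : 0 < t := ht
  have := hG x (x + t • h)
  rw [add_sub_cancel_left, real_inner_smul_right] at this
  rw [real_inner_smul_left]
  have h5 := (mul_nonneg_iff_of_pos_left ht).mp this
  positivity

lemma volume_image_null {G : 𝔼 → 𝔼} {K : NNReal} (hG : LipschitzWith K G) {s : Set 𝔼}
    (hs : volume s = 0) : volume (G '' s) = 0 := by
  have h1 : (volume : Measure 𝔼) ≪ Measure.hausdorffMeasure (Module.finrank ℝ 𝔼 : ℝ) :=
    Measure.absolutelyContinuous_isAddHaarMeasure _ _
  have h2 : (Measure.hausdorffMeasure (Module.finrank ℝ 𝔼 : ℝ)) ≪ (volume : Measure 𝔼) :=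
    Measure.absolutelyContinuous_isAddHaarMeasure _ _
  apply h1
  have := hG.hausdorffMeasure_image_le (d := Module.finrank ℝ 𝔼) (by positivity) s
  rw [h2 hs, mul_zero] at this
  exact le_antisymm this (by simp)

/-- The total Monge-Ampere mass of a convex function with Lipschitz gradient is the volume of the
gradient image. -/
lemma integral_det (hn : 1 ≤ n) {u : 𝔼 → ℝ} (hu : ConvexOn ℝ Set.univ u) {C : ℝ} (hC0 : 0 ≤ C)
    (hC : ∀ x h, u (x + h) + u (x - h) - 2 * u x ≤ C * ‖h‖ ^ 2) :
    ∫ v, (fderiv ℝ (gradient u) v).det = (volume (Set.range (gradient u))).toReal := by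
  have hlip := gradient_lipschitz hu hC0 hC
  have hreg := regular hu hC
  set G := gradient u with hGdef
  have hmono : ∀ x y, 0 ≤ ⟪G y - G x, y - x⟫ := by
    intro x y
    have h1 := (hreg x).2.1 y
    have h2 := (hreg y).2.1 x
    rw [← neg_sub y x, inner_neg_right] at h2
    rw [inner_sub_left]; linarith
  -- gradient constant along segments
  have hseg : ∀ x y, G x = G y → ∀ t : ℝ, 0 ≤ t → t ≤ 1 → G (x + t • (y - x)) = G x := by
    intro x y hxy t ht0 ht1
    have hmin : ∀ z, u (x + t • (y - x)) + ⟪G x, z - (x + t • (y - x))⟫ ≤ u z := by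
      intro z
      have h1 := (hreg x).2.1 z
      have h2 := (hreg y).2.1 x
      have h4 := hu.2 (Set.mem_univ x) (Set.mem_univ y) (sub_nonneg.mpr ht1) ht0 (by ring)
      have h5 : (1 - t) • x + t • y = x + t • (y - x) := by module
      rw [h5, smul_eq_mul, smul_eq_mul] at h4
      rw [← hxy, ← neg_sub y x, inner_neg_right] at h2
      have e : z - (x + t • (y - x)) = (z - x) - t • (y - x) := by abel
      rw [e, inner_sub_right, real_inner_smul_right]
      nlinarith
    have hF : IsLocalMin (fun z => u z - ⟪G x, z⟫) (x + t • (y - x)) := by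
      refine Eventually.of_forall fun z => ?_
      have := hmin z
      rw [inner_sub_right] at this
      show u (x + t • (y - x)) - _ ≤ u z - _
      linarith
    have hd : HasFDerivAt (fun z => u z - ⟪G x, z⟫)
        (InnerProductSpace.toDual ℝ 𝔼 (G (x + t • (y - x))) - InnerProductSpace.toDual ℝ 𝔼 (G x))
        (x + t • (y - x)) :=
      (hreg _).1.hasFDerivAt.sub (InnerProductSpace.toDual ℝ 𝔼 (G x)).hasFDerivAt
    have h0 := hF.hasFDerivAt_eq_zero hd
    exact (InnerProductSpace.toDual ℝ 𝔼).injective (sub_eq_zero.mp h0)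
  let D : Set 𝔼 := {x | DifferentiableAt ℝ G x}
  let E : Set 𝔼 := D ∩ {x | (fderiv ℝ G x).det ≠ 0}
  have hDm : MeasurableSet D := measurableSet_of_differentiableAt ℝ G
  have hdetm : Measurable fun x => (fderiv ℝ G x).det :=
    ContinuousLinearMap.continuous_det.measurable.comp (measurable_fderiv ℝ G)
  have hEm : MeasurableSet E :=
    hDm.inter (hdetm (measurableSet_singleton (0:ℝ)).compl)
  have hinj : Set.InjOn G E := by
    intro x hx y hy hxy
    by_contra hne
    apply hx.2
    have hline : HasLineDerivAt ℝ G (fderiv ℝ G x (y - x)) x (y - x) :=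
      (show DifferentiableAt ℝ G x from hx.1).hasFDerivAt.hasLineDerivAt _
    have h2 := hline.tendsto_slope_zero_right
    have h3 : Tendsto (fun t : ℝ => t⁻¹ • (G (x + t • (y - x)) - G x)) (nhdsWithin 0 (Set.Ioi 0))
      (nhds 0) := by
      refine tendsto_const_nhds.congr' ?_
      filter_upwards [Ioo_mem_nhdsGT (show (0:ℝ) < 1 by norm_num)] with t ht
      rw [hseg x y hxy t ht.1.le ht.2.le, sub_self, smul_zero]
    have h4 := tendsto_nhds_unique h2 h3
    by_contra hdet
    have hker : LinearMap.ker (fderiv ℝ G x : 𝔼 →ₗ[ℝ] 𝔼) = ⊥ :=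
      ((LinearMap.isUnit_iff_ker_eq_bot _).mp
        ((LinearMap.isUnit_iff_isUnit_det _).mpr (isUnit_iff_ne_zero.mpr hdet)))
    have h5 : y - x ∈ LinearMap.ker (fderiv ℝ G x : 𝔼 →ₗ[ℝ] 𝔼) := h4
    rw [hker, Submodule.mem_bot, sub_eq_zero] at h5
    exact hne h5.symm
  have hnn : ∀ x, 0 ≤ (fderiv ℝ G x).det := by
    intro x
    apply det_nonneg_of_monotone
    intro h
    by_cases hd : DifferentiableAt ℝ G x
    · exact fderiv_monotone hmono hd h
    · simp [fderiv_zero_of_not_differentiableAt hd]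
  have hDc : volume Dᶜ = 0 := hlip.ae_differentiableAt (μ := volume)
  have himg : volume (Set.range G) = volume (G '' E) := by
    apply le_antisymm
    · have hcov : Set.range G ⊆ G '' E ∪ (G '' (D ∩ {x | (fderiv ℝ G x).det = 0}) ∪ G '' Dᶜ) := by
        rintro _ ⟨x, rfl⟩
        by_cases hx : x ∈ D
        · by_cases h0 : (fderiv ℝ G x).det = 0
          · exact Or.inr (Or.inl ⟨x, ⟨hx, h0⟩, rfl⟩)
          · exact Or.inl ⟨x, ⟨hx, h0⟩, rfl⟩
        · exact Or.inr (Or.inr ⟨x, hx, rfl⟩)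
      refine (measure_mono hcov).trans ((measure_union_le _ _).trans ?_)
      have z1 : volume (G '' (D ∩ {x | (fderiv ℝ G x).det = 0})) = 0 :=
        addHaar_image_eq_zero_of_det_fderivWithin_eq_zero volume
          (fun x hx => (show DifferentiableAt ℝ G x from hx.1).hasFDerivAt.hasFDerivWithinAt)
          (fun x hx => hx.2)
      rw [measure_union_null z1 (volume_image_null hlip hDc), add_zero]
    · exact measure_mono (Set.image_subset_range _ _)
  have hcv := lintegral_abs_det_fderiv_eq_addHaar_image volume hEm
    (fun x hx => (show DifferentiableAt ℝ G x from hx.1).hasFDerivAt.hasFDerivWithinAt (s := E)) hinj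
  rw [himg, ← hcv, integral_eq_lintegral_of_nonneg_ae (Eventually.of_forall hnn)
    hdetm.aestronglyMeasurable]
  congr 1
  rw [← lintegral_add_compl _ hEm]
  have hz : ∫⁻ x in Eᶜ, ENNReal.ofReal (fderiv ℝ G x).det = 0 := by
    rw [setLIntegral_congr_fun (g := fun _ => 0) hEm.compl]
    · simp
    · intro x hx
      have : (fderiv ℝ G x).det ≤ 0 := by
        by_contra h
        push Not at h
        have hnd : ¬ DifferentiableAt ℝ G x := fun hd => hx ⟨hd, h.ne'⟩
        rw [fderiv_zero_of_not_differentiableAt hnd, ContinuousLinearMap.det,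
          ContinuousLinearMap.toLinearMap_zero, LinearMap.det_zero] at h
        simp [zero_pow (by omega : n ≠ 0)] at h
      simp [this]
  rw [hz, add_zero]
  refine setLIntegral_congr_fun hEm fun x _ => ?_
  rw [abs_of_nonneg (hnn x)]

end general

section envelope
open scoped Pointwise
variable {n : ℕ}

local notation "𝔼" => EuclideanSpace ℝ (Fin n)

lemma le_convEnv {φ g : 𝔼 → ℝ} (hg : ConvexOn ℝ Set.univ g) (h : ∀ w, g w ≤ φ w) (v : 𝔼) :
    g v ≤ convEnv φ v := by
  refine le_csSup ⟨φ v, ?_⟩ ⟨g, hg, h, rfl⟩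
  rintro y ⟨g', -, h', rfl⟩
  exact h' v

lemma convEnv_le {φ g : 𝔼 → ℝ} (hg : ConvexOn ℝ Set.univ g) (h : ∀ w, g w ≤ φ w) (v : 𝔼) :
    convEnv φ v ≤ φ v := by
  refine csSup_le ⟨_, g, hg, h, rfl⟩ ?_
  rintro y ⟨g', -, h', rfl⟩
  exact h' v

lemma convexOn_convEnv {φ g : 𝔼 → ℝ} (hg : ConvexOn ℝ Set.univ g) (h : ∀ w, g w ≤ φ w) :
    ConvexOn ℝ Set.univ (convEnv φ) := by
  refine ⟨convex_univ, fun x _ y _ a b ha hb hab => ?_⟩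
  refine csSup_le ⟨_, g, hg, h, rfl⟩ ?_
  rintro _ ⟨g', hg', h', rfl⟩
  refine (hg'.2 (Set.mem_univ x) (Set.mem_univ y) ha hb hab).trans ?_
  simp only [smul_eq_mul]
  gcongr
  · exact le_convEnv hg' h' x
  · exact le_convEnv hg' h' y

lemma convEnv_semiconcave {φ g : 𝔼 → ℝ} (hg : ConvexOn ℝ Set.univ g) (h : ∀ w, g w ≤ φ w) {C : ℝ}
    (hC : ∀ x h, φ (x + h) + φ (x - h) - 2 * φ x ≤ C * ‖h‖ ^ 2) (x d : 𝔼) :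
    convEnv φ (x + d) + convEnv φ (x - d) - 2 * convEnv φ x ≤ C * ‖d‖ ^ 2 := by
  have hu := convexOn_convEnv hg h
  have hw : ConvexOn ℝ Set.univ
      (fun z => (1/2 : ℝ) * convEnv φ (z + d) + (1/2 : ℝ) * convEnv φ (z - d) - C * ‖d‖ ^ 2 / 2) := by
    refine ⟨convex_univ, fun x _ y _ a b ha hb hab => ?_⟩
    have h1 := hu.2 (Set.mem_univ (x + d)) (Set.mem_univ (y + d)) ha hb hab
    have h2 := hu.2 (Set.mem_univ (x - d)) (Set.mem_univ (y - d)) ha hb hab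
    have e1 : a • (x + d) + b • (y + d) = a • x + b • y + d := by
      have : d = (a + b) • d := by rw [hab, one_smul]
      nth_rewrite 3 [this]; module
    have e2 : a • (x - d) + b • (y - d) = a • x + b • y - d := by
      have : d = (a + b) • d := by rw [hab, one_smul]
      nth_rewrite 3 [this]; module
    rw [e1] at h1
    rw [e2] at h2
    simp only [smul_eq_mul] at h1 h2 ⊢
    have e3 : C * ‖d‖ ^ 2 / 2 = a * (C * ‖d‖ ^ 2 / 2) + b * (C * ‖d‖ ^ 2 / 2) := by
      rw [← add_mul, hab, one_mul]
    linarith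
  have := le_convEnv hw (φ := φ) (fun z => by
    have h1 := convEnv_le hg h (z + d)
    have h2 := convEnv_le hg h (z - d)
    have h3 := hC z d
    linarith) x
  linarith

lemma lse_semiconcave (A : Finset 𝔼) (hA : A.Nonempty) :
    ∃ C : ℝ, 0 ≤ C ∧ ∀ x h : 𝔼, Real.log (∑ α ∈ A, Real.exp ⟪α, x + h⟫) +
      Real.log (∑ α ∈ A, Real.exp ⟪α, x - h⟫) - 2 * Real.log (∑ α ∈ A, Real.exp ⟪α, x⟫)
      ≤ C * ‖h‖ ^ 2 := by
  obtain ⟨M, hM⟩ : ∃ M : ℝ, ∀ α ∈ A, ‖α‖ ≤ M :=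
    ⟨∑ α ∈ A, ‖α‖, fun α hα => Finset.single_le_sum (f := fun α : 𝔼 => ‖α‖)
      (fun _ _ => norm_nonneg _) hα⟩
  refine ⟨2 * M ^ 2, by positivity, fun x h => ?_⟩
  have hpos : ∀ y : 𝔼, 0 < ∑ α ∈ A, Real.exp ⟪α, y⟫ := fun y =>
    Finset.sum_pos (fun _ _ => Real.exp_pos _) hA
  have key : (∑ α ∈ A, Real.exp ⟪α, x + h⟫) * (∑ α ∈ A, Real.exp ⟪α, x - h⟫) ≤
      Real.exp (2 * M ^ 2 * ‖h‖ ^ 2) * (∑ α ∈ A, Real.exp ⟪α, x⟫) ^ 2 := by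
    have e1 : (∑ α ∈ A, Real.exp ⟪α, x + h⟫) * (∑ α ∈ A, Real.exp ⟪α, x - h⟫) =
        ∑ α ∈ A, ∑ β ∈ A, Real.exp ⟪α, x⟫ * Real.exp ⟪β, x⟫ * Real.exp (⟪α, h⟫ - ⟪β, h⟫) := by
      rw [Finset.sum_mul_sum]
      refine Finset.sum_congr rfl fun α _ => Finset.sum_congr rfl fun β _ => ?_
      rw [← Real.exp_add, ← Real.exp_add, ← Real.exp_add, inner_add_right, inner_sub_right]
      congr 1; ring
    have e2 : (∑ α ∈ A, Real.exp ⟪α, x + h⟫) * (∑ α ∈ A, Real.exp ⟪α, x - h⟫) =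
        ∑ α ∈ A, ∑ β ∈ A, Real.exp ⟪α, x⟫ * Real.exp ⟪β, x⟫ * Real.exp (-(⟪α, h⟫ - ⟪β, h⟫)) := by
      rw [e1, Finset.sum_comm]
      refine Finset.sum_congr rfl fun α _ => Finset.sum_congr rfl fun β _ => ?_
      rw [neg_sub]; ring
    have e3 : (∑ α ∈ A, Real.exp ⟪α, x + h⟫) * (∑ α ∈ A, Real.exp ⟪α, x - h⟫) =
        ∑ α ∈ A, ∑ β ∈ A, Real.exp ⟪α, x⟫ * Real.exp ⟪β, x⟫ * Real.cosh (⟪α, h⟫ - ⟪β, h⟫) := by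
      have : ∀ a b c : ℝ, a = b → a = c → a = (b + c) / 2 := by intros; linarith
      rw [this _ _ _ e1 e2, ← Finset.sum_add_distrib, Finset.sum_div]
      refine Finset.sum_congr rfl fun α _ => ?_
      rw [← Finset.sum_add_distrib, Finset.sum_div]
      refine Finset.sum_congr rfl fun β _ => ?_
      rw [Real.cosh_eq]; ring
    rw [e3, sq (∑ α ∈ A, Real.exp ⟪α, x⟫), Finset.sum_mul_sum, Finset.mul_sum]
    refine Finset.sum_le_sum fun α hα => ?_
    rw [Finset.mul_sum]
    refine Finset.sum_le_sum fun β hβ => ?_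
    rw [mul_comm]
    refine mul_le_mul_of_nonneg_right ((Real.cosh_le_exp_half_sq _).trans ?_) (by positivity)
    rw [Real.exp_le_exp]
    have h1 : |⟪α, h⟫ - ⟪β, h⟫| ≤ 2 * M * ‖h‖ := by
      rw [← inner_sub_left]
      refine (abs_real_inner_le_norm _ _).trans ?_
      gcongr
      refine (norm_sub_le _ _).trans ?_
      linarith [hM α hα, hM β hβ]
    have h2 : (⟪α, h⟫ - ⟪β, h⟫) ^ 2 ≤ (2 * M * ‖h‖) ^ 2 := by
      rw [← sq_abs]; gcongr
    nlinarith
  have := Real.log_le_log (mul_pos (hpos _) (hpos _)) key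
  rw [Real.log_mul (hpos _).ne' (hpos _).ne', Real.log_mul (Real.exp_pos _).ne'
    (pow_pos (hpos _) 2).ne', Real.log_exp, Real.log_pow] at this
  push_cast at this
  linarith

lemma chi_semiconcave {χ : 𝔼 → ℝ} (hχ : ContDiff ℝ (⊤ : ℕ∞) χ) (hχc : HasCompactSupport χ) :
    ∃ C : ℝ, 0 ≤ C ∧ ∀ x h : 𝔼, χ (x + h) + χ (x - h) - 2 * χ x ≤ C * ‖h‖ ^ 2 := by
  have hd : ContDiff ℝ 1 (fderiv ℝ χ) := hχ.fderiv_right (by norm_cast)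
  obtain ⟨K, hK⟩ := hd.lipschitzWith_of_hasCompactSupport (hχc.fderiv ℝ) one_ne_zero
  refine ⟨2 * K, by positivity, fun x h => ?_⟩
  have hdiff : Differentiable ℝ χ := hχ.differentiable (by simp)
  have hder : ∀ z : 𝔼, HasFDerivAt (fun z => χ (x + z) + χ (x - z))
      (fderiv ℝ χ (x + z) - fderiv ℝ χ (x - z)) z := by
    intro z
    have h1 : HasFDerivAt (fun z => χ (x + z)) (fderiv ℝ χ (x + z)) z := by
      have := (hdiff (x + z)).hasFDerivAt.comp z ((hasFDerivAt_id z).const_add x)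
      rw [ContinuousLinearMap.comp_id] at this
      exact this
    have h2 : HasFDerivAt (fun z => χ (x - z)) (-fderiv ℝ χ (x - z)) z := by
      have := (hdiff (x - z)).hasFDerivAt.comp z ((hasFDerivAt_id z).const_sub x)
      rw [ContinuousLinearMap.comp_neg, ContinuousLinearMap.comp_id] at this
      exact this
    rw [sub_eq_add_neg]
    exact h1.add h2
  have := (convex_closedBall (0 : 𝔼) ‖h‖).norm_image_sub_le_of_norm_hasFDerivWithin_le
    (f := fun z => χ (x + z) + χ (x - z)) (C := 2 * K * ‖h‖) (x := 0) (y := h)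
    (fun z _ => (hder z).hasFDerivWithinAt) (fun z hz => by
      have h1 := hK.norm_sub_le (x + z) (x - z)
      have h2 : x + z - (x - z) = (2 : ℝ) • z := by rw [two_smul]; abel
      rw [h2, norm_smul] at h1
      have h3 : ‖z‖ ≤ ‖h‖ := by simpa using hz
      have h4 : (K : ℝ) * ‖z‖ ≤ K * ‖h‖ := by gcongr
      norm_num at h1
      linarith) (by simp) (by simp)
  have h5 := (le_abs_self _).trans this
  simp only [add_zero, sub_zero] at h5
  nlinarith

lemma inner_le_of_mem_hull {A : Finset 𝔼} {p v : 𝔼} (hp : p ∈ convexHull ℝ (A : Set 𝔼)) {c : ℝ}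
    (hc : ∀ α ∈ A, ⟪α, v⟫ ≤ c) : ⟪p, v⟫ ≤ c := by
  have hconv : Convex ℝ {q : 𝔼 | ⟪q, v⟫ ≤ c} := by
    have := convex_halfSpace_le (𝕜 := ℝ) (f := fun q : 𝔼 => ⟪q, v⟫)
      ⟨fun a b => inner_add_left _ _ _, fun a b => real_inner_smul_left _ _ _⟩ c
    exact this
  exact convexHull_min (fun α hα => hc α hα) hconv hp

/-- gradient image sandwich -/
lemma gradient_range {u : 𝔼 → ℝ} (hu : ConvexOn ℝ Set.univ u) {C : ℝ}
    (hC : ∀ x h, u (x + h) + u (x - h) - 2 * u x ≤ C * ‖h‖ ^ 2)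
    (A : Finset 𝔼) {B : ℝ} (hlow : ∀ α ∈ A, ∀ v, ⟪α, v⟫ - B ≤ u v)
    (hup : ∀ v c, (∀ α ∈ A, ⟪α, v⟫ ≤ c) → u v ≤ c + B) :
    interior (convexHull ℝ (A : Set 𝔼)) ⊆ Set.range (gradient u) ∧
    Set.range (gradient u) ⊆ convexHull ℝ (A : Set 𝔼) := by
  have hreg := regular hu hC
  constructor
  · intro p hp
    obtain ⟨r, hr, hball⟩ := Metric.nhds_basis_closedBall.mem_iff.mp (mem_interior_iff_mem_nhds.mp hp)
    have hcoer : ∀ v, r * ‖v‖ - B ≤ u v - ⟪p, v⟫ := by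
      intro v
      by_cases hv : v = 0
      · subst hv
        have : p ∈ convexHull ℝ (A : Set 𝔼) := interior_subset hp
        have hne : (A : Set 𝔼).Nonempty := convexHull_nonempty_iff.mp ⟨p, this⟩
        obtain ⟨α, hα⟩ := hne
        have := hlow α hα 0
        simpa using this
      have hvn : 0 < ‖v‖ := norm_pos_iff.mpr hv
      have hm : p + (r / ‖v‖) • v ∈ convexHull ℝ (A : Set 𝔼) := by
        apply hball
        rw [Metric.mem_closedBall, dist_eq_norm, add_sub_cancel_left, norm_smul, Real.norm_of_nonneg
          (by positivity), div_mul_cancel₀ _ hvn.ne']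
      have := inner_le_of_mem_hull hm (v := v) (c := u v + B)
        (fun α hα => by linarith [hlow α hα v])
      rw [inner_add_left, real_inner_smul_left, real_inner_self_eq_norm_sq] at this
      have e : r / ‖v‖ * ‖v‖ ^ 2 = r * ‖v‖ := by field_simp
      linarith
    have hcont : Continuous fun v => u v - ⟪p, v⟫ :=
      hu.locallyLipschitz.continuous.sub (continuous_const.inner continuous_id)
    have htend : Tendsto (fun v => u v - ⟪p, v⟫) (cocompact 𝔼) atTop := by
      refine tendsto_atTop_mono hcoer ?_
      exact tendsto_atTop_add_const_right _ _ ((tendsto_norm_cocompact_atTop).const_mul_atTop hr)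
    obtain ⟨x, hx⟩ := hcont.exists_forall_le htend
    refine ⟨x, ?_⟩
    have hF : IsLocalMin (fun v => u v - ⟪p, v⟫) x := Eventually.of_forall hx
    have hd : HasFDerivAt (fun z => u z - ⟪p, z⟫)
        (InnerProductSpace.toDual ℝ 𝔼 (gradient u x) - InnerProductSpace.toDual ℝ 𝔼 p) x :=
      (hreg _).1.hasFDerivAt.sub (InnerProductSpace.toDual ℝ 𝔼 p).hasFDerivAt
    have h0 := hF.hasFDerivAt_eq_zero hd
    exact (InnerProductSpace.toDual ℝ 𝔼).injective (sub_eq_zero.mp h0)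
  · rintro _ ⟨x, rfl⟩
    by_contra hnot
    obtain ⟨f, s, hs, hf⟩ := geometric_hahn_banach_closed_point (convex_convexHull ℝ (A : Set 𝔼))
      (A.finite_toSet.isCompact_convexHull (𝕜 := ℝ)).isClosed hnot
    obtain ⟨w, rfl⟩ := (InnerProductSpace.toDual ℝ 𝔼).surjective f
    simp only [InnerProductSpace.toDual_apply_apply] at hs hf
    set p := gradient u x
    obtain ⟨M, hM⟩ : ∃ M : ℝ, ∀ α ∈ A, ⟪α, x⟫ ≤ M :=
      ⟨∑ α ∈ A, |⟪α, x⟫|, fun α hα => (le_abs_self _).trans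
        (Finset.single_le_sum (f := fun α : 𝔼 => |⟪α, x⟫|) (fun _ _ => abs_nonneg _) hα)⟩
    have hall : ∀ t : ℝ, 0 ≤ t → t * (⟪w, p⟫ - s) ≤ M + B - u x := by
      intro t ht
      have h1 := (hreg x).2.1 (x + t • w)
      rw [add_sub_cancel_left, real_inner_smul_right, real_inner_comm] at h1
      have h2 := hup (x + t • w) (M + t * s) (fun α hα => by
        rw [inner_add_right, real_inner_smul_right, real_inner_comm w α]
        have := hs α (subset_convexHull ℝ _ hα)
        have := mul_le_mul_of_nonneg_left this.le ht
        linarith [hM α hα])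
      linarith
    have hpos : 0 < ⟪w, p⟫ - s := by linarith
    have := hall ((|M + B - u x| + 1) / (⟪w, p⟫ - s)) (by positivity)
    rw [div_mul_cancel₀ _ hpos.ne'] at this
    linarith [le_abs_self (M + B - u x)]

lemma lattice_count {Δ : Set 𝔼} (hb : Bornology.IsBounded Δ) (hm : MeasurableSet Δ)
    (hfr : volume (frontier Δ) = 0) (Λ : ℕ → Finset 𝔼)
    (hΛ : ∀ k : ℕ, 1 ≤ k → ((Λ k : Set 𝔼)
      = Δ ∩ {p | ∀ i, ∃ m : ℤ, p i = (m : ℝ) / (k : ℝ)})) :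
    Tendsto (fun k : ℕ => ((Λ k).card : ℝ) / (k : ℝ) ^ n) atTop (nhds (volume Δ).toReal) := by
  let e : (Fin n → ℝ) ≃L[ℝ] 𝔼 := (EuclideanSpace.equiv (Fin n) ℝ).symm
  have hmp : MeasurePreserving e := PiLp.volume_preserving_toLp (Fin n)
  have h := tendsto_card_div_pow_atTop_volume (e ⁻¹' Δ)
    ?_ (e.continuous.measurable hm) ?_
  · have hv : volume.real (e ⁻¹' Δ) = (volume Δ).toReal := by
      rw [Measure.real, hmp.measure_preimage hm.nullMeasurableSet]
    rw [hv] at h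
    refine h.congr' ?_
    filter_upwards [eventually_ge_atTop 1] with k hk
    rw [Fintype.card_fin]
    congr 2
    have hk0 : (k : ℝ) ≠ 0 := by positivity
    have hset : e ⁻¹' Δ ∩ ((k : ℝ)⁻¹ • (Submodule.span ℤ (Set.range (Pi.basisFun ℝ (Fin n))) :
        Set (Fin n → ℝ))) = e ⁻¹' (Λ k : Set 𝔼) := by
      rw [hΛ k hk, Set.preimage_inter]
      congr 1
      ext x
      rw [Set.mem_inv_smul_set_iff₀ hk0, SetLike.mem_coe, Module.Basis.mem_span_iff_repr_mem]
      simp only [Set.mem_preimage, Set.mem_setOf_eq]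
      refine forall_congr' fun i => ?_
      simp only [Pi.basisFun_repr, Set.mem_range, Pi.smul_apply, smul_eq_mul]
      refine exists_congr fun m => ?_
      have : (e x) i = x i := rfl
      rw [this, eq_div_iff hk0]
      simp only [algebraMap_int_eq, eq_intCast]
      constructor <;> intro h <;> linarith
    have h1 : Nat.card ↑(e ⁻¹' (Λ k : Set 𝔼)) = (Λ k).card := by
      rw [Nat.card_preimage_of_injective e.injective (by simp [e.surjective.range_eq])]
      simp
    rw [← h1, ← hset]
  · have := e.symm.lipschitz.isBounded_image hb
    rwa [e.symm.image_eq_preimage_symm] at this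
  · have hfe : frontier (e ⁻¹' Δ) = e ⁻¹' frontier Δ := (e.toHomeomorph.preimage_frontier Δ).symm
    rw [hfe]
    exact (hmp.measure_preimage (isClosed_frontier.measurableSet.nullMeasurableSet)).trans hfr

end envelope
end ToricVol

/-- toric model of `Vol(L) = lim k^{−n} dim H⁰(X, L^k) = ∫_X μ_φ`. With
`φ = φ_Δ + χ` as in the toric setup and `Λ_k = Δ ∩ (k^{−1}ℤ)ⁿ` (whose cardinality is
`dim H⁰(X_Δ, L_Δ^k)`), the normalized lattice point counts `k^{−n} card(Λ_k)` converge to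
the total Monge–Ampère mass `∫ MA[φ_e]` of the convex envelope `φ_e`, and this mass equals
`vol_n(Δ)`. Here `MA[φ_e](v) = det(D(∇φ_e)(v))` (with `fderiv` taking the junk value `0`,
of vanishing determinant since `n ≥ 1`, at points of non-differentiability). -/
theorem volume_eq_lattice_count_limit_toric (n : ℕ) (hn : 1 ≤ n)
    (S : Finset (EuclideanSpace ℝ (Fin n)))
    (hS : ∀ α ∈ S, ∀ i, ∃ m : ℤ, α i = (m : ℝ))
    (Δ : Set (EuclideanSpace ℝ (Fin n)))
    (hΔ : Δ = convexHull ℝ (S : Set (EuclideanSpace ℝ (Fin n))))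
    (hΔint : (interior Δ).Nonempty)
    (A : Finset (EuclideanSpace ℝ (Fin n)))
    (hA : (A : Set (EuclideanSpace ℝ (Fin n))) = Δ ∩ {v | ∀ i, ∃ m : ℤ, v i = (m : ℝ)})
    (φΔ χ φ : EuclideanSpace ℝ (Fin n) → ℝ)
    (hφΔ : ∀ v, φΔ v = Real.log (∑ α ∈ A, Real.exp ⟪α, v⟫))
    (hχ : ContDiff ℝ (⊤ : ℕ∞) χ) (hχc : HasCompactSupport χ)
    (hφ : φ = φΔ + χ)
    (Λ : ℕ → Finset (EuclideanSpace ℝ (Fin n)))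
    (hΛ : ∀ k : ℕ, 1 ≤ k → ((Λ k : Set (EuclideanSpace ℝ (Fin n)))
      = Δ ∩ {p | ∀ i, ∃ m : ℤ, p i = (m : ℝ) / (k : ℝ)})) :
    Tendsto (fun k : ℕ => ((Λ k).card : ℝ) / (k : ℝ) ^ n) atTop
      (nhds (∫ v, (fderiv ℝ (gradient (convEnv φ)) v).det)) ∧
    (∫ v, (fderiv ℝ (gradient (convEnv φ)) v).det) = (volume Δ).toReal := by
  have hconvΔ : Convex ℝ Δ := hΔ ▸ convex_convexHull ℝ _
  have hcompΔ : IsCompact Δ := hΔ ▸ S.finite_toSet.isCompact_convexHull (𝕜 := ℝ)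
  have hfr : volume (frontier Δ) = 0 := hconvΔ.addHaar_frontier volume
  have hhull : convexHull ℝ (A : Set (EuclideanSpace ℝ (Fin n))) = Δ := by
    apply Set.Subset.antisymm
    · refine convexHull_min ?_ hconvΔ
      rw [hA]; exact Set.inter_subset_left
    · nth_rewrite 1 [hΔ]
      refine convexHull_mono fun α hα => ?_
      rw [hA]
      exact ⟨hΔ ▸ subset_convexHull ℝ _ hα, hS α hα⟩
  have hAne : A.Nonempty := by
    have : (convexHull ℝ (A : Set (EuclideanSpace ℝ (Fin n)))).Nonempty :=
      hhull ▸ hΔint.mono interior_subset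
    exact_mod_cast convexHull_nonempty_iff.mp this
  obtain ⟨b, hb⟩ := hχc.exists_bound_of_continuous hχ.continuous
  obtain ⟨C1, hC10, hC1⟩ := ToricVol.lse_semiconcave A hAne
  obtain ⟨C2, hC20, hC2⟩ := ToricVol.chi_semiconcave hχ hχc
  have hφv : ∀ v, φ v = Real.log (∑ α ∈ A, Real.exp ⟪α, v⟫) + χ v := fun v => by
    rw [hφ, Pi.add_apply, hφΔ]
  have hφC : ∀ x h, φ (x + h) + φ (x - h) - 2 * φ x ≤ (C1 + C2) * ‖h‖ ^ 2 := by
    intro x h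
    rw [hφv, hφv, hφv]
    linarith [hC1 x h, hC2 x h]
  have hlow : ∀ α ∈ A, ∀ v, ⟪α, v⟫ - b ≤ φ v := by
    intro α hα v
    have h1 : ⟪α, v⟫ ≤ Real.log (∑ α ∈ A, Real.exp ⟪α, v⟫) := by
      rw [Real.le_log_iff_exp_le (Finset.sum_pos (fun _ _ => Real.exp_pos _) hAne)]
      exact Finset.single_le_sum (f := fun α => Real.exp ⟪α, v⟫)
        (fun _ _ => (Real.exp_pos _).le) hα
    have h2 := (abs_le.mp (hb v)).1
    rw [hφv]; linarith
  have hup : ∀ v c, (∀ α ∈ A, ⟪α, v⟫ ≤ c) → φ v ≤ c + (b + Real.log A.card) := by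
    intro v c hc
    have hcard : (0 : ℝ) < A.card := by exact_mod_cast hAne.card_pos
    have h1 : Real.log (∑ α ∈ A, Real.exp ⟪α, v⟫) ≤ Real.log (A.card * Real.exp c) := by
      refine Real.log_le_log (Finset.sum_pos (fun _ _ => Real.exp_pos _) hAne) ?_
      rw [← nsmul_eq_mul]
      exact Finset.sum_le_card_nsmul _ _ _ fun α hα => Real.exp_le_exp.mpr (hc α hα)
    rw [Real.log_mul hcard.ne' (Real.exp_pos _).ne', Real.log_exp] at h1
    have h2 := (abs_le.mp (hb v)).2
    rw [hφv]; linarith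
  have hlinconv : ∀ α : EuclideanSpace ℝ (Fin n), ConvexOn ℝ Set.univ (fun v => ⟪α, v⟫ - b) := by
    intro α
    refine ⟨convex_univ, fun x _ y _ s t hs ht hst => le_of_eq ?_⟩
    simp only [inner_add_right, real_inner_smul_right, smul_eq_mul]
    linear_combination b * hst
  obtain ⟨α₀, hα₀⟩ := hAne
  have hg := hlinconv α₀
  have hgφ := hlow α₀ hα₀
  have hu := ToricVol.convexOn_convEnv hg hgφ
  have huC := ToricVol.convEnv_semiconcave hg hgφ hφC
  have hlogn : 0 ≤ Real.log A.card := Real.log_natCast_nonneg _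
  obtain ⟨hsub1, hsub2⟩ := ToricVol.gradient_range hu huC A (B := b + Real.log A.card)
    (fun α hα v => by linarith [ToricVol.le_convEnv (hlinconv α) (hlow α hα) v])
    (fun v c hc => (ToricVol.convEnv_le hg hgφ v).trans (hup v c hc))
  rw [hhull] at hsub1 hsub2
  have hint : ∫ v, (fderiv ℝ (gradient (convEnv φ)) v).det = (volume Δ).toReal := by
    rw [ToricVol.integral_det hn hu (add_nonneg hC10 hC20) huC]
    congr 1
    refine le_antisymm (measure_mono hsub2) ?_
    rw [← measure_interior_of_null_frontier hfr]
    exact measure_mono hsub1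
  refine ⟨?_, hint⟩
  rw [hint]
  exact ToricVol.lattice_count hcompΔ.isBounded hcompΔ.measurableSet hfr Λ hΛ
end
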